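/- arXiv:1505.01523 — 3 statements merged into one kernel-verified Lean document; each statement's English description precedes it below -/
import Mathlib

section
/- Chernoff bounds for twisted tabulation with value functions (Theorem 5, tail bounds): for all constants c ≥ 2, γ > 0 and ε > 0 there exist constants α > 0 and C such that the following holds. Let u = |Σ|^c and let h : Σ^c → Σ^c be a random twisted tabulation hash function (range [u]). For each key x ∈ Σ^c let v_x : [u] → [0,1] be an arbitrary fixed value function; set V_x = v_x(h(x)), V = Σ_{x} V_x, μ_x = E[v_x(U)] for U uniform in [u], and μ = Σ_x μ_x. If μ < |Σ|^{1−ε}, then for every δ > 0: Pr[V ≥ (1+δ)μ] ≤ (e^δ/(1+δ)^{(1+δ)})^{α μ} + C/u^γ, and for every 0 < δ ≤ 1: Pr[V ≤ (1−δ)μ] ≤ (e^{−δ}/(1−δ)^{(1−δ)})^{α μ} + C/u^γ. -/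
open scoped Classical
open Finset

set_option synthInstance.maxSize 1024
set_option synthInstance.maxHeartbeats 1000000
set_option maxHeartbeats 1000000

/-- Bit strings of length `n`, identified with `(𝔽₂)^n`; bitwise XOR is
coordinatewise addition in `ZMod 2`.  This models the set `[2^n]`. -/
abbrev Bits (n : ℕ) : Type := Fin n → ZMod 2

/-- Keys with `c = k + 1` characters over the alphabet `Σ = [2^s]`: a head in `Σ` and a
tail in `Σ^k`.  This type plays the role of the universe `[u]`, `u = |Σ|^c`. -/
abbrev Key (s k : ℕ) : Type := Bits s × (Fin k → Bits s)

/-- Probability of an event under the uniform distribution on a finite sample space. -/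
noncomputable def Pr {Ω : Type*} [Fintype Ω] (E : Ω → Prop) : ℝ :=
  ((Finset.univ.filter E).card : ℝ) / (Fintype.card Ω : ℝ)

/-- Twisted tabulation hashing with `c = k + 1` characters (head `x.1`, tail `x.2`):
`(t, h_{>0}) = ⊕_i ω.1 i (x.2 i)` and the output is `h_{>0} ⊕ ω.2 (x.1 ⊕ t)`. -/
def twistedTab {s k : ℕ} {R : Type*} [AddCommMonoid R]
    (ω : (Fin k → Bits s → Bits s × R) × (Bits s → R))
    (x : Key s k) : R :=
  let p := ∑ i, ω.1 i (x.2 i)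
  p.2 + ω.2 (x.1 + p.1)

section TwistedAux

/-- Simple tabulation. -/
def simpTab {k : ℕ} {A R : Type*} [AddCommGroup R] (g : Fin k → A → R) (y : Fin k → A) : R :=
  ∑ i, g i (y i)

/-- A key is new relative to `L` if it has a position character not used by `L`. -/
def IsNew {k : ℕ} {A : Type*} (L : Finset (Fin k → A)) (y : Fin k → A) : Prop :=
  ∃ p, ∀ z ∈ L, z p ≠ y p

/-- Sum over peelable tuples of products of weights. -/
noncomputable def peelSum {k : ℕ} {A : Type*} [DecidableEq A] [Fintype A] (w : (Fin k → A) → ℝ) :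
    ℕ → Finset (Fin k → A) → ℝ
  | 0, _ => 1
  | n + 1, L => ∑ y, if IsNew L y then w y * peelSum w n (insert y L) else 0

lemma peelSum_nonneg {k : ℕ} {A : Type*} [DecidableEq A] [Fintype A] (w : (Fin k → A) → ℝ)
    (hw : ∀ y, 0 ≤ w y) (n : ℕ) : ∀ L, 0 ≤ peelSum w n L := by
  induction n with
  | zero => intro L; simp [peelSum]
  | succ n ih =>
    intro L
    rw [peelSum]
    refine Finset.sum_nonneg fun y _ => ?_
    split_ifs
    · exact mul_nonneg (hw y) (ih _)
    · exact le_rfl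

lemma card_not_new {k : ℕ} {A : Type*} [DecidableEq A] [Fintype A] (L : Finset (Fin k → A)) :
    (univ.filter fun y => ¬ IsNew L y).card ≤ L.card ^ k := by
  calc (univ.filter fun y => ¬ IsNew L y).card
      ≤ (Fintype.piFinset fun p : Fin k => L.image fun z => z p).card := by
        apply Finset.card_le_card
        intro y hy
        simp only [Finset.mem_filter, Finset.mem_univ, true_and, IsNew, not_exists, not_forall,
          not_not] at hy
        rw [Fintype.mem_piFinset]
        intro p
        obtain ⟨z, hz, h⟩ := hy p
        exact Finset.mem_image.2 ⟨z, hz, h⟩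
    _ = ∏ p : Fin k, (L.image fun z => z p).card := Fintype.card_piFinset _
    _ ≤ ∏ _p : Fin k, L.card := Finset.prod_le_prod' fun p _ => Finset.card_image_le
    _ = L.card ^ k := by simp

lemma one_le_peelSum {k : ℕ} {A : Type*} [DecidableEq A] [Fintype A] (w : (Fin k → A) → ℝ)
    (hw : ∀ y, 0 ≤ w y) (hw1 : ∀ y, w y ≤ 1) (N : ℕ)
    (hW : ((N ^ k + 1 : ℕ) : ℝ) ≤ ∑ y, w y) (n : ℕ) :
    ∀ L : Finset (Fin k → A), L.card + n ≤ N → 1 ≤ peelSum w n L := by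
  induction n with
  | zero => intro L _; simp [peelSum]
  | succ n ih =>
    intro L hL
    rw [peelSum]
    have h1 : ∑ y, (if IsNew L y then w y else 0) ≤
        ∑ y, (if IsNew L y then w y * peelSum w n (insert y L) else 0) := by
      refine Finset.sum_le_sum fun y _ => ?_
      split_ifs
      · refine le_mul_of_one_le_right (hw y) (ih _ ?_)
        have := Finset.card_insert_le y L
        omega
      · exact le_rfl
    refine le_trans ?_ h1
    have h2 : ∑ y, w y = ∑ y, (if IsNew L y then w y else 0) +
        ∑ y, (if ¬ IsNew L y then w y else 0) := by
      rw [← Finset.sum_add_distrib]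
      refine Finset.sum_congr rfl fun y _ => ?_
      by_cases h : IsNew L y <;> simp [h]
    have h3 : ∑ y, (if ¬ IsNew L y then w y else 0) ≤ ((N ^ k : ℕ) : ℝ) := by
      rw [← Finset.sum_filter]
      calc ∑ y ∈ univ.filter (fun y => ¬ IsNew L y), w y
          ≤ ∑ y ∈ univ.filter (fun y => ¬ IsNew L y), (1 : ℝ) :=
            Finset.sum_le_sum fun y _ => hw1 y
        _ = ((univ.filter (fun y => ¬ IsNew L y)).card : ℝ) := by simp
        _ ≤ _ := by
          exact_mod_cast (card_not_new L).trans (Nat.pow_le_pow_left (by omega) k)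
    push_cast at hW h3
    linarith

lemma simpTab_shift {k : ℕ} {A R : Type*} [DecidableEq A] [AddCommGroup R]
    (g : Fin k → A → R) (y : Fin k → A) (p : Fin k) (c : A) (r : R) :
    simpTab (g + Pi.single p (Pi.single c r)) y = simpTab g y + if y p = c then r else 0 := by
  unfold simpTab
  simp only [Pi.add_apply, Finset.sum_add_distrib]
  congr 1
  rw [Finset.sum_eq_single p]
  · simp [Pi.single_apply]
  · intro i _ hi
    simp [hi]
  · simp

lemma avg_new {k : ℕ} {A R : Type*} [DecidableEq A] [Fintype A] [AddCommGroup R] [Fintype R]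
    (F : (Fin k → A → R) → ℝ) (w : R → ℝ) (y : Fin k → A) (p : Fin k)
    (hF : ∀ r g, F (g + Pi.single p (Pi.single (y p) r)) = F g) :
    ∑ g, F g * w (simpTab g y) = (∑ r, w r) / (Fintype.card R : ℝ) * ∑ g, F g := by
  have hc : (Fintype.card R : ℝ) ≠ 0 := by
    exact_mod_cast Fintype.card_ne_zero
  have key : ∀ r : R, ∑ g, F g * w (simpTab g y) = ∑ g, F g * w (simpTab g y + r) := by
    intro r
    rw [← Equiv.sum_comp (Equiv.addRight (Pi.single p (Pi.single (y p) r)))]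
    refine Finset.sum_congr rfl fun g _ => ?_
    simp only [Equiv.coe_addRight]
    rw [hF, simpTab_shift]
    simp
  have : (Fintype.card R : ℝ) * ∑ g, F g * w (simpTab g y) = (∑ r, w r) * ∑ g, F g := by
    calc (Fintype.card R : ℝ) * ∑ g, F g * w (simpTab g y)
        = ∑ _r : R, ∑ g, F g * w (simpTab g y) := by simp
      _ = ∑ r : R, ∑ g, F g * w (simpTab g y + r) := Finset.sum_congr rfl fun r _ => key r
      _ = ∑ g, ∑ r : R, F g * w (simpTab g y + r) := Finset.sum_comm
      _ = ∑ g, F g * ∑ r, w r := by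
        refine Finset.sum_congr rfl fun g _ => ?_
        rw [← Finset.mul_sum]
        congr 1
        exact Equiv.sum_comp (Equiv.addLeft (simpTab g y)) w
      _ = _ := by rw [← Finset.sum_mul, mul_comm]
  field_simp
  linarith

lemma peelSum_avg {k : ℕ} {A R : Type*} [DecidableEq A] [Fintype A] [AddCommGroup R] [Fintype R]
    (w : (Fin k → A) → R → ℝ) (hw : ∀ y r, 0 ≤ w y r) (m : ℝ)
    (hm : m = ∑ y, (∑ r, w y r) / (Fintype.card R : ℝ)) (n : ℕ) :
    ∀ (L : Finset (Fin k → A)) (F : (Fin k → A → R) → ℝ), (∀ g, 0 ≤ F g) →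
      (∀ p c, (∀ z ∈ L, z p ≠ c) → ∀ r g, F (g + Pi.single p (Pi.single c r)) = F g) →
      ∑ g, F g * peelSum (fun y => w y (simpTab g y)) n L ≤ m ^ n * ∑ g, F g := by
  have hm0 : 0 ≤ m := by
    rw [hm]
    exact Finset.sum_nonneg fun y _ => div_nonneg (Finset.sum_nonneg fun r _ => hw y r) (by positivity)
  induction n with
  | zero => intro L F _ _; simp [peelSum]
  | succ n ih =>
    intro L F hF hinv
    have hFs : 0 ≤ ∑ g, F g := Finset.sum_nonneg fun g _ => hF g
    calc ∑ g, F g * peelSum (fun y => w y (simpTab g y)) (n + 1) L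
        = ∑ y, ∑ g, (if IsNew L y then (F g * w y (simpTab g y)) *
            peelSum (fun y => w y (simpTab g y)) n (insert y L) else 0) := by
          rw [Finset.sum_comm]
          refine Finset.sum_congr rfl fun g _ => ?_
          rw [peelSum, Finset.mul_sum]
          refine Finset.sum_congr rfl fun y _ => ?_
          split_ifs
          · ring
          · simp
      _ ≤ ∑ y, m ^ n * ((∑ r, w y r) / (Fintype.card R : ℝ) * ∑ g, F g) := by
          refine Finset.sum_le_sum fun y _ => ?_
          by_cases hy : IsNew L y
          · simp only [hy, if_true]
            refine (ih (insert y L) (fun g => F g * w y (simpTab g y))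
              (fun g => mul_nonneg (hF g) (hw _ _)) ?_).trans ?_
            · intro p c hc r g
              have h1 := hinv p c (fun z hz => hc z (Finset.mem_insert_of_mem hz)) r g
              have h2 := hc y (Finset.mem_insert_self _ _)
              simp only [h1, simpTab_shift, h2, if_false, add_zero]
            · obtain ⟨p, hp⟩ := hy
              rw [avg_new F (w y) y p (hinv p (y p) hp)]
          · simp only [hy, if_false, Finset.sum_const_zero]
            exact mul_nonneg (pow_nonneg hm0 _) (mul_nonneg
              (div_nonneg (Finset.sum_nonneg fun r _ => hw y r) (by positivity)) hFs)
      _ = m ^ (n + 1) * ∑ g, F g := by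
          rw [← Finset.mul_sum, ← Finset.sum_mul, ← hm]
          ring

/-- Moment generating bound for sums of independent `[0,1]` variables. -/
lemma mgf_bound {A U : Type*} [DecidableEq A] [Fintype A] [Fintype U] [Nonempty U]
    (X : A → U → ℝ) (h0 : ∀ a z, 0 ≤ X a z) (h1 : ∀ a z, X a z ≤ 1) (q : ℝ) (hq : -1 ≤ q) :
    ∑ t : A → U, (1 + q) ^ (∑ a, X a (t a)) ≤
      (Fintype.card (A → U) : ℝ) *
        Real.exp (q * ∑ a, (∑ z, X a z) / (Fintype.card U : ℝ)) := by
  have hc : (Fintype.card U : ℝ) ≠ 0 := by exact_mod_cast Fintype.card_ne_zero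
  calc ∑ t : A → U, (1 + q) ^ (∑ a, X a (t a))
      = ∑ t : A → U, ∏ a, (1 + q) ^ (X a (t a)) := by
        refine Finset.sum_congr rfl fun t _ => ?_
        exact Real.rpow_sum_of_nonneg (by linarith) (fun a _ => h0 _ _)
    _ = ∏ a, ∑ z, (1 + q) ^ (X a z) := by
        rw [Finset.prod_univ_sum, Fintype.piFinset_univ]
    _ ≤ ∏ a, ((Fintype.card U : ℝ) * Real.exp (q * ((∑ z, X a z) / (Fintype.card U : ℝ)))) := by
        refine Finset.prod_le_prod (fun a _ => Finset.sum_nonneg fun z _ =>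
          Real.rpow_nonneg (by linarith) _) fun a _ => ?_
        calc ∑ z, (1 + q) ^ (X a z) ≤ ∑ z, (1 + X a z * q) :=
              Finset.sum_le_sum fun z _ =>
                rpow_one_add_le_one_add_mul_self hq (h0 a z) (h1 a z)
          _ = (Fintype.card U : ℝ) * (q * ((∑ z, X a z) / (Fintype.card U : ℝ)) + 1) := by
              rw [Finset.sum_add_distrib, ← Finset.sum_mul]
              simp only [Finset.sum_const, Finset.card_univ, nsmul_eq_mul]
              field_simp
              ring
          _ ≤ _ := mul_le_mul_of_nonneg_left (Real.add_one_le_exp _) (by positivity)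
    _ = _ := by
        rw [Finset.prod_mul_distrib, ← Real.exp_sum, ← Finset.mul_sum]
        simp

end TwistedAux
section TwistedAux2

/-- The contribution of twisted head `a` when the head table has value `z` there. -/
noncomputable def bX {k : ℕ} {A U : Type*} [Fintype A] [DecidableEq A] [AddCommGroup A]
    [AddCommGroup U] (v : A × (Fin k → A) → U → ℝ) (g : Fin k → A → A × U) (a : A) (z : U) : ℝ :=
  ∑ y : Fin k → A, v (a - (simpTab g y).1, y) ((simpTab g y).2 + z)

/-- The peelable tuple sum for twisted head `a`. -/
noncomputable def bP {k : ℕ} {A U : Type*} [Fintype A] [DecidableEq A] [AddCommGroup A]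
    [AddCommGroup U] (v : A × (Fin k → A) → U → ℝ) (l : ℕ)
    (g : Fin k → A → A × U) (a : A) (z : U) : ℝ :=
  peelSum (fun y : Fin k → A => v (a - (simpTab g y).1, y) ((simpTab g y).2 + z)) l ∅

lemma Pr_le_of {Ω : Type*} [Fintype Ω] [Nonempty Ω] (E : Ω → Prop) (f : Ω → ℝ) (c : ℝ)
    (h0 : ∀ ω, 0 ≤ f ω) (h1 : ∀ ω, E ω → 1 ≤ f ω)
    (hf : ∑ ω, f ω ≤ c * (Fintype.card Ω : ℝ)) : Pr E ≤ c := by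
  unfold Pr
  have hc : (0 : ℝ) < Fintype.card Ω := by exact_mod_cast Fintype.card_pos
  rw [div_le_iff₀ hc]
  refine le_trans ?_ hf
  rw [← Finset.sum_boole]
  refine Finset.sum_le_sum fun ω _ => ?_
  split_ifs with h
  · exact h1 ω h
  · exact h0 ω

variable {k : ℕ} {A U : Type*} [Fintype A] [DecidableEq A] [AddCommGroup A]
    [AddCommGroup U] [Fintype U]

lemma bX_nonneg (v : A × (Fin k → A) → U → ℝ) (hv : ∀ x z, 0 ≤ v x z ∧ v x z ≤ 1)
    (g : Fin k → A → A × U) (a : A) (z : U) : 0 ≤ bX v g a z :=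
  Finset.sum_nonneg fun _ _ => (hv _ _).1

lemma bP_nonneg (v : A × (Fin k → A) → U → ℝ) (hv : ∀ x z, 0 ≤ v x z ∧ v x z ≤ 1) (l : ℕ)
    (g : Fin k → A → A × U) (a : A) (z : U) : 0 ≤ bP v l g a z :=
  peelSum_nonneg _ (fun _ => (hv _ _).1) _ _

lemma one_le_bP (v : A × (Fin k → A) → U → ℝ) (hv : ∀ x z, 0 ≤ v x z ∧ v x z ≤ 1) (l : ℕ)
    (g : Fin k → A → A × U) (a : A) (z : U) (h : ((l ^ k + 1 : ℕ) : ℝ) ≤ bX v g a z) :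
    1 ≤ bP v l g a z :=
  one_le_peelSum _ (fun _ => (hv _ _).1) (fun _ => (hv _ _).2) l h l ∅ (by simp)

lemma bX_sub_le (v : A × (Fin k → A) → U → ℝ) (hv : ∀ x z, 0 ≤ v x z ∧ v x z ≤ 1) (l : ℕ)
    (g : Fin k → A → A × U) (a : A) (z : U) :
    bX v g a z - min (bX v g a z) ((l ^ k + 1 : ℕ) : ℝ) ≤
      (Fintype.card (Fin k → A) : ℝ) * bP v l g a z := by
  rcases le_total ((l ^ k + 1 : ℕ) : ℝ) (bX v g a z) with h | h
  · have h1 := one_le_bP v hv l g a z h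
    have h2 : bX v g a z ≤ (Fintype.card (Fin k → A) : ℝ) := by
      unfold bX
      refine (Finset.sum_le_sum fun y _ => (hv _ _).2).trans ?_
      simp
    rw [min_eq_right h]
    have h3 : (0 : ℝ) ≤ ((l ^ k + 1 : ℕ) : ℝ) := Nat.cast_nonneg _
    have h4 : (0 : ℝ) ≤ (Fintype.card (Fin k → A) : ℝ) := Nat.cast_nonneg _
    nlinarith
  · rw [min_eq_left h, sub_self]
    exact mul_nonneg (Nat.cast_nonneg _) (bP_nonneg v hv l g a z)

lemma sum_bP_le (v : A × (Fin k → A) → U → ℝ) (hv : ∀ x z, 0 ≤ v x z ∧ v x z ≤ 1) (l : ℕ)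
    (μ : ℝ) (hμ : μ = ∑ x, (∑ z, v x z) / (Fintype.card U : ℝ)) (a : A) (z : U) :
    ∑ g, bP v l g a z ≤
      (μ / Fintype.card A) ^ l * (Fintype.card (Fin k → A → A × U) : ℝ) := by
  have := peelSum_avg (k := k) (A := A) (R := A × U)
    (fun y q => v (a - q.1, y) (q.2 + z)) (fun _ _ => (hv _ _).1) (μ / Fintype.card A) ?_ l ∅
    (fun _ => 1) (fun _ => zero_le_one) (fun _ _ _ _ _ => rfl)
  · simpa [bP] using this
  · have h : ∀ y : Fin k → A, ∑ q : A × U, v (a - q.1, y) (q.2 + z) =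
        ∑ x0 : A, ∑ z, v (x0, y) z := by
      intro y
      rw [Fintype.sum_prod_type]
      rw [← Equiv.sum_comp (Equiv.subLeft a) (fun x0 => ∑ z, v (x0, y) z)]
      refine Finset.sum_congr rfl fun b _ => ?_
      exact Equiv.sum_comp (Equiv.addRight z) (fun z' => v (a - b, y) z')
    simp only [h]
    rw [hμ, Fintype.sum_prod_type, Finset.sum_comm, Finset.sum_div]
    refine Finset.sum_congr rfl fun y _ => ?_
    rw [← Finset.sum_div, Fintype.card_prod, div_div, Nat.cast_mul, mul_comm]

lemma sum_bX_mean (v : A × (Fin k → A) → U → ℝ)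
    (μ : ℝ) (hμ : μ = ∑ x, (∑ z, v x z) / (Fintype.card U : ℝ)) (g : Fin k → A → A × U) :
    ∑ a, (∑ z, bX v g a z) / (Fintype.card U : ℝ) = μ := by
  rw [hμ, ← Finset.sum_div, ← Finset.sum_div]
  congr 1
  unfold bX
  calc ∑ a, ∑ z, ∑ y : Fin k → A, v (a - (simpTab g y).1, y) ((simpTab g y).2 + z)
      = ∑ a, ∑ y : Fin k → A, ∑ z, v (a - (simpTab g y).1, y) z := by
        refine Finset.sum_congr rfl fun a _ => ?_
        rw [Finset.sum_comm]
        refine Finset.sum_congr rfl fun y _ => ?_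
        exact Equiv.sum_comp (Equiv.addLeft (simpTab g y).2)
          (fun z => v (a - (simpTab g y).1, y) z)
    _ = ∑ y : Fin k → A, ∑ a, ∑ z, v (a - (simpTab g y).1, y) z := Finset.sum_comm
    _ = ∑ y : Fin k → A, ∑ a, ∑ z, v (a, y) z := by
        refine Finset.sum_congr rfl fun y _ => ?_
        exact Equiv.sum_comp (Equiv.subRight (simpTab g y).1) (fun a => ∑ z, v (a, y) z)
    _ = _ := by rw [Fintype.sum_prod_type, Finset.sum_comm]

/-- Abstract upper tail. -/
lemma upper_core (v : A × (Fin k → A) → U → ℝ) (hv : ∀ x z, 0 ≤ v x z ∧ v x z ≤ 1) (l : ℕ)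
    (μ : ℝ) (hμ : μ = ∑ x, (∑ z, v x z) / (Fintype.card U : ℝ)) (D : ℝ)
    (hD : D = ((l ^ k + 1 : ℕ) : ℝ)) (δ : ℝ) (hδ : 0 < δ) :
    Pr (fun ω : (Fin k → A → A × U) × (A → U) => (1 + δ) * μ ≤ ∑ a, bX v ω.1 a (ω.2 a)) ≤
      (Fintype.card A : ℝ) * (μ / Fintype.card A) ^ l +
        Real.exp (δ * (μ / D)) / (1 + δ) ^ ((1 + δ) * μ / D) := by
  have hD1 : 1 ≤ D := by rw [hD]; push_cast; have : (0 : ℝ) ≤ (l : ℝ) ^ k := by positivity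
                         linarith
  have hD0 : 0 < D := by linarith
  have hb : 0 < (1 + δ) ^ ((1 + δ) * μ / D) := Real.rpow_pos_of_pos (by linarith) _
  refine Pr_le_of _ (fun ω => ∑ a, bP v l ω.1 a (ω.2 a) +
    (1 + δ) ^ (∑ a, min (bX v ω.1 a (ω.2 a)) D / D) / (1 + δ) ^ ((1 + δ) * μ / D)) _ ?_ ?_ ?_
  · intro ω
    exact add_nonneg (Finset.sum_nonneg fun a _ => bP_nonneg v hv _ _ _ _)
      (div_nonneg (Real.rpow_nonneg (by linarith) _) hb.le)
  · rintro ⟨g, t⟩ hE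
    simp only at hE ⊢
    by_cases h : ∃ a, D ≤ bX v g a (t a)
    · obtain ⟨a, ha⟩ := h
      rw [hD] at ha
      have h1 := one_le_bP v hv l g a (t a) ha
      have h2 := Finset.single_le_sum (f := fun a => bP v l g a (t a))
        (fun a _ => bP_nonneg v hv l g a (t a)) (Finset.mem_univ a)
      have h3 : 0 ≤ (1 + δ) ^ (∑ a, min (bX v g a (t a)) D / D) / (1 + δ) ^ ((1 + δ) * μ / D) :=
        div_nonneg (Real.rpow_nonneg (by linarith) _) hb.le
      linarith
    · push Not at h
      have h2 : 0 ≤ ∑ a, bP v l g a (t a) := Finset.sum_nonneg fun a _ => bP_nonneg v hv _ _ _ _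
      have h3 : ∑ a, min (bX v g a (t a)) D / D = (∑ a, bX v g a (t a)) / D := by
        rw [Finset.sum_div]
        exact Finset.sum_congr rfl fun a _ => by rw [min_eq_left (h a).le]
      have h4 : 1 ≤ (1 + δ) ^ (∑ a, min (bX v g a (t a)) D / D) / (1 + δ) ^ ((1 + δ) * μ / D) := by
        rw [one_le_div hb, h3]
        exact Real.rpow_le_rpow_of_exponent_le (by linarith) (by gcongr)
      linarith
  · rw [Finset.sum_add_distrib, Fintype.card_prod,
      add_mul ((Fintype.card A : ℝ) * (μ / Fintype.card A) ^ l)]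
    refine add_le_add ?_ ?_
    · rw [Fintype.sum_prod_type, Finset.sum_comm]
      calc ∑ t : A → U, ∑ g, ∑ a, bP v l g a (t a)
          = ∑ t : A → U, ∑ a, ∑ g, bP v l g a (t a) :=
            Finset.sum_congr rfl fun t _ => Finset.sum_comm
        _ ≤ ∑ _t : A → U, ∑ _a : A,
            (μ / Fintype.card A) ^ l * (Fintype.card (Fin k → A → A × U) : ℝ) :=
            Finset.sum_le_sum fun t _ => Finset.sum_le_sum fun a _ =>
              sum_bP_le v hv l μ hμ a (t a)
        _ = _ := by
            simp only [Finset.sum_const, Finset.card_univ, nsmul_eq_mul, Nat.cast_mul]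
            ring
    · rw [Fintype.sum_prod_type]
      calc ∑ g, ∑ t : A → U,
            (1 + δ) ^ (∑ a, min (bX v g a (t a)) D / D) / (1 + δ) ^ ((1 + δ) * μ / D)
          ≤ ∑ _g : Fin k → A → A × U, (Fintype.card (A → U) : ℝ) *
              (Real.exp (δ * (μ / D)) / (1 + δ) ^ ((1 + δ) * μ / D)) := by
            refine Finset.sum_le_sum fun g _ => ?_
            rw [← Finset.sum_div, ← mul_div_assoc]
            refine div_le_div_of_nonneg_right ?_ hb.le
            refine (mgf_bound (fun a z => min (bX v g a z) D / D)
              (fun a z => div_nonneg (le_min (bX_nonneg v hv g a z) hD0.le) hD0.le)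
              (fun a z => (div_le_one hD0).2 (min_le_right _ _)) δ (by linarith)).trans ?_
            gcongr
            rw [← sum_bX_mean v μ hμ g, Finset.sum_div]
            refine Finset.sum_le_sum fun a _ => ?_
            rw [← Finset.sum_div, div_right_comm]
            gcongr
            exact min_le_left _ _
        _ = _ := by
            simp only [Finset.sum_const, Finset.card_univ, nsmul_eq_mul, Nat.cast_mul]
            ring

/-- Abstract lower tail. -/
lemma lower_core (v : A × (Fin k → A) → U → ℝ) (hv : ∀ x z, 0 ≤ v x z ∧ v x z ≤ 1) (l : ℕ)
    (μ : ℝ) (hμ : μ = ∑ x, (∑ z, v x z) / (Fintype.card U : ℝ)) (D : ℝ)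
    (hD : D = ((l ^ k + 1 : ℕ) : ℝ)) (δ : ℝ) (hδ : 0 < δ) (hδ1 : δ ≤ 1) (τ : ℝ) (hτ : 0 < τ) :
    Pr (fun ω : (Fin k → A → A × U) × (A → U) => ∑ a, bX v ω.1 a (ω.2 a) ≤ (1 - δ) * μ) ≤
      (Fintype.card A : ℝ) * (Fintype.card (Fin k → A) : ℝ) * (μ / Fintype.card A) ^ l / τ +
        Real.exp (-δ * ((μ - τ) / D)) / (1 - δ) ^ ((1 - δ) * μ / D) := by
  have hU0 : (0 : ℝ) < Fintype.card U := by exact_mod_cast Fintype.card_pos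
  have hD1 : 1 ≤ D := by rw [hD]; push_cast; have : (0 : ℝ) ≤ (l : ℝ) ^ k := by positivity
                         linarith
  have hD0 : 0 < D := by linarith
  have hb : 0 < (1 - δ) ^ ((1 - δ) * μ / D) := by
    rcases eq_or_lt_of_le hδ1 with h | h
    · simp [h]
    · exact Real.rpow_pos_of_pos (by linarith) _
  set Df : (Fin k → A → A × U) → ℝ := fun g =>
    ∑ a, (∑ z, (bX v g a z - min (bX v g a z) D)) / (Fintype.card U : ℝ) with hDf
  have hDf0 : ∀ g, 0 ≤ Df g := fun g => Finset.sum_nonneg fun a _ =>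
    div_nonneg (Finset.sum_nonneg fun z _ => sub_nonneg.2 (min_le_left _ _)) hU0.le
  have hX0 : ∀ g a z, 0 ≤ min (bX v g a z) D / D := fun g a z =>
    div_nonneg (le_min (bX_nonneg v hv g a z) hD0.le) hD0.le
  refine Pr_le_of _ (fun ω => Df ω.1 / τ + if Df ω.1 ≤ τ then
    (1 - δ) ^ (∑ a, min (bX v ω.1 a (ω.2 a)) D / D) / (1 - δ) ^ ((1 - δ) * μ / D) else 0) _ ?_ ?_ ?_
  · intro ω
    refine add_nonneg (div_nonneg (hDf0 _) hτ.le) ?_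
    split_ifs
    · exact div_nonneg (Real.rpow_nonneg (by linarith) _) hb.le
    · exact le_rfl
  · rintro ⟨g, t⟩ hE
    simp only at hE ⊢
    split_ifs with h
    · have h0 := div_nonneg (hDf0 g) hτ.le
      have hle : ∑ a, min (bX v g a (t a)) D / D ≤ (1 - δ) * μ / D := by
        rw [← Finset.sum_div]
        gcongr
        refine le_trans (Finset.sum_le_sum fun a _ => min_le_left _ _) hE
      have hnn : 0 ≤ ∑ a, min (bX v g a (t a)) D / D := Finset.sum_nonneg fun a _ => hX0 g a (t a)
      have h4 : 1 ≤ (1 - δ) ^ (∑ a, min (bX v g a (t a)) D / D) / (1 - δ) ^ ((1 - δ) * μ / D) := by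
        rw [one_le_div hb]
        rcases eq_or_lt_of_le hδ1 with h' | h'
        · have : ∑ a, min (bX v g a (t a)) D / D = 0 := by
            apply le_antisymm _ hnn
            simpa [h'] using hle
          rw [this]
          simp [h']
        · exact Real.rpow_le_rpow_of_exponent_ge (by linarith) (by linarith) hle
      linarith
    · push Not at h
      have : 1 ≤ Df g / τ := by rw [one_le_div hτ]; exact h.le
      linarith
  · rw [Finset.sum_add_distrib, Fintype.card_prod, add_mul]
    refine add_le_add ?_ ?_
    · rw [Fintype.sum_prod_type]
      have key : ∑ g, Df g ≤ (Fintype.card A : ℝ) * (Fintype.card (Fin k → A) : ℝ) *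
          (μ / Fintype.card A) ^ l * (Fintype.card (Fin k → A → A × U) : ℝ) := by
        calc ∑ g, Df g ≤ ∑ g, ∑ a, (∑ z, (Fintype.card (Fin k → A) : ℝ) * bP v l g a z) /
              (Fintype.card U : ℝ) := by
              refine Finset.sum_le_sum fun g _ => Finset.sum_le_sum fun a _ => ?_
              refine div_le_div_of_nonneg_right ?_ hU0.le
              refine Finset.sum_le_sum fun z _ => ?_
              rw [hD]
              exact bX_sub_le v hv l g a z
          _ = ((Fintype.card (Fin k → A) : ℝ) / (Fintype.card U : ℝ)) *
                ∑ a, ∑ z, ∑ g, bP v l g a z := by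
              rw [Finset.sum_comm, Finset.mul_sum]
              refine Finset.sum_congr rfl fun a _ => ?_
              rw [← Finset.sum_div, Finset.sum_comm]
              simp only [← Finset.mul_sum]
              ring
          _ ≤ ((Fintype.card (Fin k → A) : ℝ) / (Fintype.card U : ℝ)) *
                ∑ _a : A, ∑ _z : U,
                  (μ / Fintype.card A) ^ l * (Fintype.card (Fin k → A → A × U) : ℝ) := by
              refine mul_le_mul_of_nonneg_left ?_ (by positivity)
              exact Finset.sum_le_sum fun a _ => Finset.sum_le_sum fun z _ =>
                sum_bP_le v hv l μ hμ a z
          _ = _ := by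
              simp only [Finset.sum_const, Finset.card_univ, nsmul_eq_mul]
              field_simp
      calc ∑ g, ∑ _t : A → U, Df g / τ
          = (Fintype.card (A → U) : ℝ) / τ * ∑ g, Df g := by
            simp only [Finset.sum_const, Finset.card_univ, nsmul_eq_mul]
            rw [Finset.mul_sum]
            exact Finset.sum_congr rfl fun g _ => by ring
        _ ≤ _ := mul_le_mul_of_nonneg_left key (by positivity)
        _ = _ := by
            rw [Nat.cast_mul]
            ring
    · rw [Fintype.sum_prod_type]
      calc ∑ g, ∑ t : A → U, (if Df g ≤ τ then
            (1 - δ) ^ (∑ a, min (bX v g a (t a)) D / D) / (1 - δ) ^ ((1 - δ) * μ / D) else 0)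
          ≤ ∑ _g : Fin k → A → A × U, (Fintype.card (A → U) : ℝ) *
              (Real.exp (-δ * ((μ - τ) / D)) / (1 - δ) ^ ((1 - δ) * μ / D)) := by
            refine Finset.sum_le_sum fun g _ => ?_
            split_ifs with hg
            · rw [← Finset.sum_div, ← mul_div_assoc]
              refine div_le_div_of_nonneg_right ?_ hb.le
              have := mgf_bound (fun a z => min (bX v g a z) D / D)
                (fun a z => hX0 g a z)
                (fun a z => (div_le_one hD0).2 (min_le_right _ _)) (-δ) (by linarith)
              rw [← sub_eq_add_neg] at this
              refine this.trans ?_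
              refine mul_le_mul_of_nonneg_left (Real.exp_le_exp.2 ?_) (by positivity)
              refine mul_le_mul_of_nonpos_left ?_ (by linarith)
              have e : ∑ a, (∑ z, min (bX v g a z) D / D) / (Fintype.card U : ℝ) =
                  (μ - Df g) / D := by
                rw [← sum_bX_mean v μ hμ g, hDf]
                simp only
                rw [← Finset.sum_sub_distrib, Finset.sum_div]
                refine Finset.sum_congr rfl fun a _ => ?_
                rw [← Finset.sum_div, Finset.sum_sub_distrib]
                field_simp
                ring
              rw [e]
              gcongr
            · rw [Finset.sum_const_zero]
              positivity
        _ = _ := by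
            simp only [Finset.sum_const, Finset.card_univ, nsmul_eq_mul, Nat.cast_mul]
            ring

end TwistedAux2

lemma twisted_sum {s k : ℕ} {U : Type*} [AddCommGroup U]
    (v : Key s k → U → ℝ)
    (ω : (Fin k → Bits s → Bits s × U) × (Bits s → U)) :
    ∑ x : Key s k, v x (twistedTab ω x) = ∑ a, bX v ω.1 a (ω.2 a) := by
  unfold bX
  rw [Fintype.sum_prod_type, Finset.sum_comm]
  rw [Finset.sum_comm (f := fun (a : Bits s) (y : Fin k → Bits s) =>
    v (a - (simpTab ω.1 y).1, y) ((simpTab ω.1 y).2 + ω.2 a))]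
  refine Finset.sum_congr rfl fun y _ => ?_
  rw [← Equiv.sum_comp (Equiv.addRight (simpTab ω.1 y).1)
    (fun a => v (a - (simpTab ω.1 y).1, y) ((simpTab ω.1 y).2 + ω.2 a))]
  refine Finset.sum_congr rfl fun x0 _ => ?_
  simp only [Equiv.coe_addRight, add_sub_cancel_right]
  rfl
/-- Chernoff bounds for twisted tabulation with value functions
(Theorem 5, tail bounds): for constants `c = k+1 ≥ 2`, `γ > 0`, `ε > 0` there are
constants `α > 0` and `C` such that for a random twisted tabulation function
`h : [u] → [u]` (`u = |Σ|^c`) and arbitrary fixed value functions `v_x : [u] → [0,1]`,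
with `V = Σ_x v_x(h(x))` and `μ = Σ_x E[v_x(U)]` (`U` uniform in `[u]`): if
`μ < |Σ|^{1−ε}`, then `Pr[V ≥ (1+δ)μ] ≤ (e^δ/(1+δ)^{1+δ})^{αμ} + C/u^γ` for all
`δ > 0`, and `Pr[V ≤ (1−δ)μ] ≤ (e^{−δ}/(1−δ)^{1−δ})^{αμ} + C/u^γ` for `0 < δ ≤ 1`. -/
theorem twisted_tabulation_chernoff (k : ℕ) (hk : 1 ≤ k) (γ ε : ℝ) (hγ : 0 < γ)
    (hε : 0 < ε) :
    ∃ α : ℝ, 0 < α ∧ ∃ C : ℝ,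
      ∀ (s : ℕ) (v : Key s k → Key s k → ℝ),
        (∀ x y, 0 ≤ v x y ∧ v x y ≤ 1) →
        ∀ μ : ℝ,
          μ = ∑ x : Key s k, (∑ y : Key s k, v x y) / (Fintype.card (Key s k) : ℝ) →
          μ < ((2 : ℝ) ^ s) ^ ((1 : ℝ) - ε) →
          (∀ δ : ℝ, 0 < δ →
            Pr (fun ω : (Fin k → Bits s → Bits s × Key s k) × (Bits s → Key s k) =>
                (1 + δ) * μ ≤ ∑ x : Key s k, v x (twistedTab ω x)) ≤
              (Real.exp δ / (1 + δ) ^ (1 + δ)) ^ (α * μ) +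
                C / (Fintype.card (Key s k) : ℝ) ^ γ) ∧
          (∀ δ : ℝ, 0 < δ → δ ≤ 1 →
            Pr (fun ω : (Fin k → Bits s → Bits s × Key s k) × (Bits s → Key s k) =>
                ∑ x : Key s k, v x (twistedTab ω x) ≤ (1 - δ) * μ) ≤
              (Real.exp (-δ) / (1 - δ) ^ (1 - δ)) ^ (α * μ) +
                C / (Fintype.card (Key s k) : ℝ) ^ γ) := by
  have hk0 : (0 : ℝ) ≤ (k : ℝ) := Nat.cast_nonneg k
  obtain ⟨l, hl⟩ := exists_nat_ge (((k : ℝ) + 1) * (1 + 2 * γ) / ε)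
  rw [div_le_iff₀ hε] at hl
  have hD1 : (1 : ℝ) ≤ ((l ^ k + 1 : ℕ) : ℝ) := by
    push_cast
    have : (0 : ℝ) ≤ (l : ℝ) ^ k := by positivity
    linarith
  obtain ⟨D, hD⟩ : ∃ D : ℝ, D = ((l ^ k + 1 : ℕ) : ℝ) := ⟨_, rfl⟩
  rw [← hD] at hD1
  have hD0 : 0 < D := by linarith
  refine ⟨1 / D, by positivity, 3, ?_⟩
  intro s v hv μ hμ hμlt
  have hμ0 : 0 ≤ μ := by
    rw [hμ]
    exact Finset.sum_nonneg fun x _ =>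
      div_nonneg (Finset.sum_nonneg fun y _ => (hv x y).1) (Nat.cast_nonneg _)
  have hcA : (Fintype.card (Bits s) : ℝ) = (2 : ℝ) ^ s := by simp [Bits]
  have hcY : (Fintype.card (Fin k → Bits s) : ℝ) = ((2 : ℝ) ^ s) ^ k := by simp [Bits]
  have hcU : (Fintype.card (Key s k) : ℝ) =
      (Fintype.card (Bits s) : ℝ) * (Fintype.card (Fin k → Bits s) : ℝ) := by
    rw [← Nat.cast_mul, ← Fintype.card_prod]
  obtain ⟨S, hS⟩ : ∃ S : ℝ, S = (2 : ℝ) ^ s := ⟨_, rfl⟩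
  have hS1 : 1 ≤ S := by rw [hS]; exact one_le_pow₀ (by norm_num)
  have hS0 : 0 < S := by linarith
  rw [← hS] at hμlt hcA hcY
  have hcU' : (Fintype.card (Key s k) : ℝ) = S ^ ((k : ℝ) + 1) := by
    rw [hcU, hcA, hcY, Real.rpow_add hS0, Real.rpow_natCast, Real.rpow_one, mul_comm]
  obtain ⟨u, hu⟩ : ∃ u : ℝ, u = (Fintype.card (Key s k) : ℝ) := ⟨_, rfl⟩
  rw [← hu] at hcU hcU'
  have hu1 : 1 ≤ u := by rw [hcU']; exact Real.one_le_rpow hS1 (by linarith)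
  have hu0 : 0 < u := by linarith
  obtain ⟨τ, hτ⟩ : ∃ τ : ℝ, τ = u ^ (-γ) := ⟨_, rfl⟩
  have hτ0 : 0 < τ := by rw [hτ]; exact Real.rpow_pos_of_pos hu0 _
  have hτ1 : τ ≤ 1 := by
    rw [hτ]; exact Real.rpow_le_one_of_one_le_of_nonpos hu1 (by linarith)
  have hC : (3 : ℝ) / u ^ γ = 3 * τ := by
    rw [hτ, Real.rpow_neg hu0.le, div_eq_mul_inv]
  obtain ⟨β, hβ⟩ : ∃ β : ℝ, β = (μ / (Fintype.card (Bits s) : ℝ)) ^ l := ⟨_, rfl⟩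
  have hβ0 : 0 ≤ β := by rw [hβ]; positivity
  have huβ : u * β ≤ τ * τ := by
    have h1 : μ / (Fintype.card (Bits s) : ℝ) ≤ S ^ (-ε) := by
      rw [hcA, div_le_iff₀ hS0]
      refine hμlt.le.trans (le_of_eq ?_)
      rw [sub_eq_neg_add, Real.rpow_add hS0, Real.rpow_one]
    have h2 : β ≤ S ^ (-(((k : ℝ) + 1) * (1 + 2 * γ))) := by
      rw [hβ]
      refine (pow_le_pow_left₀ (by positivity) h1 l).trans ?_
      rw [← Real.rpow_natCast, ← Real.rpow_mul hS0.le]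
      exact Real.rpow_le_rpow_of_exponent_le hS1 (by linarith)
    have h3 : S ^ (-(((k : ℝ) + 1) * (1 + 2 * γ))) = u ^ (-(1 + 2 * γ)) := by
      rw [hcU', ← Real.rpow_mul hS0.le]
      congr 1
      ring
    have h4 : u * u ^ (-(1 + 2 * γ)) = τ * τ := by
      rw [hτ, ← Real.rpow_add hu0]
      nth_rewrite 1 [← Real.rpow_one u]
      rw [← Real.rpow_add hu0]
      congr 1
      ring
    rw [← h4, ← h3]
    exact mul_le_mul_of_nonneg_left h2 hu0.le
  rw [← hu, hC]
  simp only [twisted_sum]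
  refine ⟨fun δ hδ => ?_, fun δ hδ hδ1 => ?_⟩
  · refine (upper_core v hv l μ hμ D hD δ hδ).trans ?_
    rw [← hβ]
    have h1 : Real.exp (δ * (μ / D)) / (1 + δ) ^ ((1 + δ) * μ / D) =
        (Real.exp δ / (1 + δ) ^ (1 + δ)) ^ (1 / D * μ) := by
      rw [Real.div_rpow (Real.exp_pos _).le (Real.rpow_nonneg (by linarith) _),
        ← Real.exp_mul, ← Real.rpow_mul (by linarith)]
      congr 2 <;> ring
    rw [h1]
    have h2 : (Fintype.card (Bits s) : ℝ) * β ≤ u * β := by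
      refine mul_le_mul_of_nonneg_right ?_ hβ0
      rw [hcU, hcA, hcY]
      exact le_mul_of_one_le_right hS0.le (one_le_pow₀ hS1)
    nlinarith
  · refine (lower_core v hv l μ hμ D hD δ hδ hδ1 τ hτ0).trans ?_
    rw [← hβ, ← hcU]
    have hb0 : (0 : ℝ) ≤ 1 - δ := by linarith
    have h0 : u * β / τ ≤ τ := by rw [div_le_iff₀ hτ0]; exact huβ
    have h1 : Real.exp (-δ * ((μ - τ) / D)) / (1 - δ) ^ ((1 - δ) * μ / D) =
        (Real.exp (-δ) / (1 - δ) ^ (1 - δ)) ^ (1 / D * μ) * Real.exp (δ * τ / D) := by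
      rw [Real.div_rpow (Real.exp_pos _).le (Real.rpow_nonneg hb0 _),
        ← Real.exp_mul, ← Real.rpow_mul hb0, div_mul_eq_mul_div, ← Real.exp_add]
      congr 2 <;> ring
    rw [h1]
    have hbase : Real.exp (-δ) / (1 - δ) ^ (1 - δ) ≤ 1 := by
      rcases eq_or_lt_of_le hδ1 with h | h
      · simp [h]
      · have hb : 0 < 1 - δ := by linarith
        rw [div_le_one (Real.rpow_pos_of_pos hb _), Real.rpow_def_of_pos hb, Real.exp_le_exp]
        have := Real.one_sub_inv_le_log_of_pos hb
        have h5 := mul_le_mul_of_nonneg_right this hb.le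
        rw [sub_mul, inv_mul_cancel₀ hb.ne'] at h5
        linarith
    have hB1 : (Real.exp (-δ) / (1 - δ) ^ (1 - δ)) ^ (1 / D * μ) ≤ 1 :=
      Real.rpow_le_one (div_nonneg (Real.exp_pos _).le (Real.rpow_nonneg hb0 _)) hbase
        (by positivity)
    have hB0 : 0 ≤ (Real.exp (-δ) / (1 - δ) ^ (1 - δ)) ^ (1 / D * μ) :=
      Real.rpow_nonneg (div_nonneg (Real.exp_pos _).le (Real.rpow_nonneg hb0 _)) _
    have hx : δ * τ / D ≤ τ := by
      rw [div_le_iff₀ hD0]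
      nlinarith
    have hx0 : 0 ≤ δ * τ / D := by positivity
    have he : Real.exp (δ * τ / D) ≤ 1 + 2 * τ := by
      have h6 : |δ * τ / D| ≤ 1 := by rw [abs_of_nonneg hx0]; linarith
      have h7 := Real.abs_exp_sub_one_le h6
      rw [abs_of_nonneg hx0] at h7
      have := le_abs_self (Real.exp (δ * τ / D) - 1)
      linarith
    nlinarith [mul_le_mul_of_nonneg_left he hB0]
end

section
/- Concentration for twisted tabulation at large expectation (Theorem 5, equation (8)): for all constants c ≥ 2 and γ > 0 there exist constants C and K such that the following holds. Let u = |Σ|^c and let h : Σ^c → Σ^c be a random twisted tabulation hash function (range [u]). For each key x ∈ Σ^c let v_x : [u] → [0,1] be an arbitrary fixed value function; set V = Σ_x v_x(h(x)) and μ = Σ_x E[v_x(U)] for U uniform in [u]. If μ ≥ √|Σ|, then with probability at least 1 − u^{−γ}, |V − μ| ≤ C·√μ·(log u)^K. -/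
open scoped Classical
open Finset

set_option synthInstance.maxSize 1024
set_option synthInstance.maxHeartbeats 1000000
set_option maxHeartbeats 1000000

/-- Number of points satisfying a predicate. -/
noncomputable def ttCnt {A : Type*} [Fintype A] (P : A → Prop) : ℝ :=
  ((univ.filter P).card : ℝ)

lemma ttCnt_mono {A : Type*} [Fintype A] {P Q : A → Prop} (h : ∀ a, P a → Q a) :
    ttCnt P ≤ ttCnt Q := by
  unfold ttCnt
  exact Nat.cast_le.2 (Finset.card_le_card (Finset.monotone_filter_right _ fun a _ => h a))

lemma ttCnt_equiv {A B : Type*} [Fintype A] [Fintype B] (e : A ≃ B) {P : A → Prop}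
    {Q : B → Prop} (h : ∀ a, P a ↔ Q (e a)) : ttCnt P = ttCnt Q := by
  unfold ttCnt
  congr 1
  apply Finset.card_equiv e
  intro a
  simpa using h a

lemma ttCnt_or {A : Type*} [Fintype A] (P Q : A → Prop) :
    ttCnt (fun a => P a ∨ Q a) ≤ ttCnt P + ttCnt Q := by
  unfold ttCnt
  have : (univ.filter (fun a => P a ∨ Q a)) ⊆ univ.filter P ∪ univ.filter Q := by
    intro a ha
    simpa using ha
  exact_mod_cast (Finset.card_le_card (by convert this)).trans (Finset.card_union_le _ _)

lemma ttCnt_sum {A : Type*} [Fintype A] (P : A → Prop) :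
    ttCnt P = ∑ a, if P a then (1 : ℝ) else 0 := by
  unfold ttCnt
  simp

lemma ttCnt_le {A : Type*} [Fintype A] (P : A → Prop) : ttCnt P ≤ Fintype.card A := by
  unfold ttCnt
  exact_mod_cast Finset.card_le_univ _

lemma ttCnt_not {A : Type*} [Fintype A] (P : A → Prop) :
    ttCnt P + ttCnt (fun a => ¬ P a) = Fintype.card A := by
  simp only [ttCnt_sum]
  rw [← Finset.sum_add_distrib]
  trans ∑ a : A, (1 : ℝ)
  · refine Finset.sum_congr rfl fun a _ => ?_
    by_cases h : P a <;> simp [h]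
  · simp

lemma tt_chern {A R : Type*} [Fintype A] [DecidableEq A] [Fintype R] [Nonempty R] (Z : A → R → ℝ) (t : ℝ)
    (hmean : ∀ a, ∑ z, Z a z = 0) (hb : ∀ a z, |Z a z| ≤ 1)
    (hvar : ∑ a, (∑ z, Z a z ^ 2) / (Fintype.card R : ℝ) ≤ 1) :
    ttCnt (fun f : A → R => t < ∑ a, Z a (f a))
      ≤ Real.exp (1 - t) * (Fintype.card (A → R) : ℝ) := by
  have hR : (0 : ℝ) < Fintype.card R := by exact_mod_cast Fintype.card_pos
  have h1 : ∑ f : A → R, Real.exp (∑ a, Z a (f a)) ≤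
      Real.exp 1 * (Fintype.card (A → R) : ℝ) := by
    have e1 : ∑ f : A → R, Real.exp (∑ a, Z a (f a)) = ∏ a, ∑ z, Real.exp (Z a z) := by
      rw [Finset.prod_univ_sum]
      simp [Real.exp_sum]
    rw [e1]
    have e2 : ∀ a, ∑ z, Real.exp (Z a z) ≤
        Real.exp ((∑ z, Z a z ^ 2) / (Fintype.card R : ℝ)) * (Fintype.card R : ℝ) := by
      intro a
      have : ∑ z, Real.exp (Z a z) ≤ ∑ z, (1 + Z a z + Z a z ^ 2) := by
        apply Finset.sum_le_sum
        intro z _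
        have := abs_le.1 (Real.abs_exp_sub_one_sub_id_le (hb a z))
        linarith [this.2]
      refine this.trans ?_
      rw [Finset.sum_add_distrib, Finset.sum_add_distrib, hmean a]
      simp only [sum_const, card_univ, nsmul_eq_mul, mul_one, add_zero]
      have h3 := Real.add_one_le_exp ((∑ z, Z a z ^ 2) / (Fintype.card R : ℝ))
      calc (Fintype.card R : ℝ) + ∑ z, Z a z ^ 2
          = ((∑ z, Z a z ^ 2) / (Fintype.card R : ℝ) + 1) * (Fintype.card R : ℝ) := by
            field_simp; ring
        _ ≤ _ := by gcongr
    calc ∏ a, ∑ z, Real.exp (Z a z)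
        ≤ ∏ a, (Real.exp ((∑ z, Z a z ^ 2) / (Fintype.card R : ℝ)) * (Fintype.card R : ℝ)) :=
          Finset.prod_le_prod (fun a _ => Finset.sum_nonneg fun z _ => (Real.exp_pos _).le)
            (fun a _ => e2 a)
      _ = Real.exp (∑ a, (∑ z, Z a z ^ 2) / (Fintype.card R : ℝ)) *
            (Fintype.card (A → R) : ℝ) := by
          rw [Finset.prod_mul_distrib, Real.exp_sum]
          simp
      _ ≤ _ := by gcongr
  have h2 : ttCnt (fun f : A → R => t < ∑ a, Z a (f a)) * Real.exp t
      ≤ ∑ f : A → R, Real.exp (∑ a, Z a (f a)) := by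
    rw [ttCnt_sum, Finset.sum_mul]
    apply Finset.sum_le_sum
    intro f _
    split_ifs with hf
    · rw [one_mul]; exact Real.exp_le_exp.2 hf.le
    · rw [zero_mul]; exact (Real.exp_pos _).le
  have h3 := h2.trans h1
  rw [Real.exp_sub, div_mul_eq_mul_div, le_div_iff₀ (Real.exp_pos t)]
  exact h3

lemma tt_chern2 {A R : Type*} [Fintype A] [DecidableEq A] [Fintype R] [Nonempty R] (Z : A → R → ℝ) (t : ℝ)
    (hmean : ∀ a, ∑ z, Z a z = 0) (hb : ∀ a z, |Z a z| ≤ 1)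
    (hvar : ∑ a, (∑ z, Z a z ^ 2) / (Fintype.card R : ℝ) ≤ 1) :
    ttCnt (fun f : A → R => t < |∑ a, Z a (f a)|)
      ≤ 2 * Real.exp (1 - t) * (Fintype.card (A → R) : ℝ) := by
  have h1 := tt_chern Z t hmean hb hvar
  have h2 := tt_chern (fun a z => - Z a z) t (by intro a; simp [hmean a])
    (by intro a z; simpa using hb a z) (by simpa using hvar)
  have h3 := (ttCnt_mono (P := fun f : A → R => t < |∑ a, Z a (f a)|) fun f hf => by
    have := lt_abs.1 hf
    rwa [← Finset.sum_neg_distrib] at this).trans (ttCnt_or _ _)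
  linarith

/-- One step: independent nonnegative terms, each uniformly close to `lam a`. -/
lemma tt_step {A R : Type*} [Fintype A] [DecidableEq A] [Fintype R] [Nonempty R] (X : A → R → ℝ)
    (lam : A → ℝ) (l L δ : ℝ) (hL : 1 ≤ L) (hδ : 0 < δ)
    (hX : ∀ a z, 0 ≤ X a z) (hlam : ∀ a, 0 ≤ lam a) (hl : ∑ a, lam a = l)
    (hm : ∑ a, (∑ z, X a z) / (Fintype.card R : ℝ) = l)
    (hdev : ∀ a z, |X a z - lam a| ≤ L * Real.sqrt (max (lam a) 1)) :
    ttCnt (fun f : A → R =>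
        3 * (1 + Real.log (1 / δ)) * L * Real.sqrt (max l 1) < |∑ a, X a (f a) - l|)
      ≤ 2 * δ * (Fintype.card (A → R) : ℝ) := by
  have hR : (0 : ℝ) < Fintype.card R := by exact_mod_cast Fintype.card_pos
  set m : A → ℝ := fun a => (∑ z, X a z) / (Fintype.card R : ℝ) with hmdef
  have hmc : ∀ a, ∑ z, X a z = m a * Fintype.card R := by
    intro a; simp only [hmdef]; field_simp
  set D := Real.sqrt (max l 1) with hD
  have hD1 : 1 ≤ D := by rw [hD]; exact Real.one_le_sqrt.2 (le_max_right _ _)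
  have hDsq : D ^ 2 = max l 1 := Real.sq_sqrt (by positivity)
  set M := 3 * L * D with hM
  have hMpos : 0 < M := by positivity
  have hm0 : ∀ a, 0 ≤ m a := fun a =>
    div_nonneg (Finset.sum_nonneg fun z _ => hX a z) hR.le
  have hdm : ∀ a, |m a - lam a| ≤ L * Real.sqrt (max (lam a) 1) := by
    intro a
    have : m a - lam a = (∑ z, (X a z - lam a)) / Fintype.card R := by
      rw [Finset.sum_sub_distrib]; simp only [hmdef, sum_const, card_univ, nsmul_eq_mul]
      field_simp
    rw [this, abs_div, abs_of_pos hR, div_le_iff₀ hR]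
    calc |∑ z, (X a z - lam a)| ≤ ∑ z, |X a z - lam a| := Finset.abs_sum_le_sum_abs _ _
      _ ≤ ∑ z : R, L * Real.sqrt (max (lam a) 1) := Finset.sum_le_sum fun z _ => hdev a z
      _ = _ := by simp [mul_comm]
  have hY : ∀ a z, |X a z - m a| ≤ 2 * L * Real.sqrt (max (lam a) 1) := by
    intro a z
    have h1 := abs_le.1 (hdev a z)
    have h2 := abs_le.1 (hdm a)
    rw [abs_le]; constructor <;> linarith [h1.1, h1.2, h2.1, h2.2]
  have hla : ∀ a, lam a ≤ l := by
    intro a; rw [← hl]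
    exact Finset.single_le_sum (f := lam) (fun b _ => hlam b) (Finset.mem_univ a)
  have hvarY : ∀ a, (∑ z, (X a z - m a) ^ 2) / (Fintype.card R : ℝ)
      ≤ 4 * L ^ 2 * (lam a + m a) := by
    intro a
    rw [div_le_iff₀ hR]
    rcases le_or_gt 1 (lam a) with h | h
    · have : ∀ z, (X a z - m a) ^ 2 ≤ 4 * L ^ 2 * lam a := by
        intro z
        have h1 := hY a z
        rw [max_eq_left h] at h1
        have h2 := pow_le_pow_left₀ (abs_nonneg _) h1 2
        rw [sq_abs, mul_pow, Real.sq_sqrt (hlam a)] at h2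
        linarith
      calc ∑ z, (X a z - m a) ^ 2 ≤ ∑ z : R, 4 * L ^ 2 * lam a :=
            Finset.sum_le_sum fun z _ => this z
        _ = 4 * L ^ 2 * lam a * Fintype.card R := by simp [mul_comm]
        _ ≤ _ := by
            gcongr
            linarith [hm0 a]
    · have hXb : ∀ z, X a z ≤ 2 * L := by
        intro z
        have h1 := hdev a z
        rw [max_eq_right h.le, Real.sqrt_one, mul_one] at h1
        linarith [(abs_le.1 h1).2]
      calc ∑ z, (X a z - m a) ^ 2
          = ∑ z, (X a z ^ 2 - 2 * m a * X a z + m a ^ 2) := by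
            apply Finset.sum_congr rfl; intros; ring
        _ = ∑ z, X a z ^ 2 - 2 * m a * ∑ z, X a z + Fintype.card R * m a ^ 2 := by
            rw [Finset.sum_add_distrib, Finset.sum_sub_distrib, ← Finset.mul_sum]; simp
        _ ≤ ∑ z, X a z ^ 2 := by
            rw [hmc a]
            nlinarith [mul_nonneg hR.le (sq_nonneg (m a))]
        _ ≤ ∑ z, 2 * L * X a z := by
            apply Finset.sum_le_sum
            intro z _
            nlinarith [hXb z, hX a z]
        _ = 2 * L * m a * Fintype.card R := by rw [← Finset.mul_sum, hmc a]; ring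
        _ ≤ _ := by
            refine mul_le_mul_of_nonneg_right ?_ hR.le
            have : 2 * L ≤ 4 * L ^ 2 := by nlinarith
            have h5 : 2 * L * m a ≤ 4 * L ^ 2 * m a := mul_le_mul_of_nonneg_right this (hm0 a)
            have h6 : 0 ≤ 4 * L ^ 2 * lam a := mul_nonneg (by positivity) (hlam a)
            linarith
  have key := tt_chern2 (fun a z => (X a z - m a) / M) (1 + Real.log (1 / δ)) ?_ ?_ ?_
  · have hex : Real.exp (1 - (1 + Real.log (1 / δ))) = δ := by
      rw [one_div, Real.log_inv]
      have : (1 : ℝ) - (1 + -Real.log δ) = Real.log δ := by ring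
      rw [this, Real.exp_log hδ]
    rw [hex] at key
    refine le_trans ?_ key
    apply ttCnt_mono
    intro f hf
    rw [← Finset.sum_div, Finset.sum_sub_distrib, abs_div, abs_of_pos hMpos, lt_div_iff₀ hMpos]
    have : ∑ a, m a = l := hm
    rw [this]
    refine lt_of_eq_of_lt ?_ hf
    rw [hM]; ring
  · intro a
    rw [← Finset.sum_div, Finset.sum_sub_distrib, hmc a]
    simp [mul_comm]
  · intro a z
    rw [abs_div, abs_of_pos hMpos, div_le_one hMpos]
    refine (hY a z).trans ?_
    have : Real.sqrt (max (lam a) 1) ≤ D := Real.sqrt_le_sqrt (max_le_max (hla a) le_rfl)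
    rw [hM]
    have h7 : 0 ≤ Real.sqrt (max (lam a) 1) := Real.sqrt_nonneg _
    have : 2 * L * Real.sqrt (max (lam a) 1) ≤ 2 * L * D := by gcongr
    have : 0 ≤ L * D := by positivity
    linarith
  · have : ∀ a, (∑ z, ((X a z - m a) / M) ^ 2) / (Fintype.card R : ℝ)
        ≤ 4 * L ^ 2 * (lam a + m a) / M ^ 2 := by
      intro a
      have : ∑ z, ((X a z - m a) / M) ^ 2 = (∑ z, (X a z - m a) ^ 2) / M ^ 2 := by
        rw [Finset.sum_div]; simp [div_pow]
      rw [this, div_right_comm]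
      gcongr
      exact hvarY a
    refine (Finset.sum_le_sum fun a _ => this a).trans ?_
    rw [← Finset.sum_div, ← Finset.mul_sum, Finset.sum_add_distrib, hl]
    have : ∑ a, m a = l := hm
    rw [this, div_le_one (by positivity), hM, mul_pow, mul_pow, hDsq]
    have h8 : l ≤ max l 1 := le_max_left _ _
    have h9 : 0 ≤ max l 1 := by positivity
    have h10 : L ^ 2 * l ≤ L ^ 2 * max l 1 := by gcongr
    have h11 : 0 ≤ L ^ 2 * max l 1 := by positivity
    linarith

lemma tt_fub {A B : Type*} [Fintype A] [Fintype B] (P : A → B → Prop) (Good : A → Prop)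
    (p q : ℝ) (hq : 0 ≤ q)
    (h1 : ttCnt (fun a => ¬ Good a) ≤ p * Fintype.card A)
    (h2 : ∀ a, Good a → ttCnt (fun b => P a b) ≤ q * Fintype.card B) :
    ttCnt (fun x : A × B => P x.1 x.2)
      ≤ (p + q) * (Fintype.card A * Fintype.card B) := by
  have e : ttCnt (fun x : A × B => P x.1 x.2) =
      ∑ a, ttCnt (fun b => P a b) := by
    simp only [ttCnt_sum]
    rw [Fintype.sum_prod_type]
  rw [e]
  have hh : ∀ a, ttCnt (fun b => P a b) ≤
      (if ¬ Good a then (Fintype.card B : ℝ) else 0) + q * Fintype.card B := by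
    intro a
    by_cases hg : Good a
    · simpa [hg] using h2 a hg
    · simp only [hg, not_false_eq_true, if_true]
      have : ttCnt (fun b => P a b) ≤ Fintype.card B := by
        exact ttCnt_le _
      have : 0 ≤ q * (Fintype.card B : ℝ) := by positivity
      linarith
  refine (Finset.sum_le_sum fun a _ => hh a).trans ?_
  have hs : ∑ a, (if ¬ Good a then (Fintype.card B : ℝ) else 0) =
      ttCnt (fun a => ¬ Good a) * Fintype.card B := by
    rw [ttCnt_sum, Finset.sum_mul]
    refine Finset.sum_congr rfl fun a _ => ?_
    split_ifs <;> simp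
  rw [Finset.sum_add_distrib, hs]
  simp only [sum_const, nsmul_eq_mul, card_univ]
  have := mul_le_mul_of_nonneg_right h1 (Nat.cast_nonneg (α := ℝ) (Fintype.card B))
  linarith

lemma tt_union {A I : Type*} [Fintype A] [Fintype I] (P : I → A → Prop) (p : ℝ)
    (h : ∀ i, ttCnt (fun a => ¬ P i a) ≤ p * Fintype.card A) :
    ttCnt (fun a => ¬ ∀ i, P i a) ≤
      (Fintype.card I * p) * Fintype.card A := by
  have h2 : ttCnt (fun a => ¬ ∀ i, P i a) ≤ ∑ i, ttCnt (fun a => ¬ P i a) := by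
    simp only [ttCnt_sum]
    rw [Finset.sum_comm]
    refine Finset.sum_le_sum fun a _ => ?_
    by_cases hP : ∀ i, P i a
    · rw [if_neg (not_not.2 hP)]
      exact Finset.sum_nonneg fun i _ => by split_ifs <;> norm_num
    · rw [if_pos hP]
      push Not at hP
      obtain ⟨i, hi⟩ := hP
      refine le_trans (le_of_eq (if_pos hi).symm)
        (Finset.single_le_sum (f := fun i => @ite ℝ (¬ P i a) (Classical.propDecidable _) 1 0)
        (fun i _ => ?_) (Finset.mem_univ i))
      split_ifs <;> norm_num
  refine h2.trans ((Finset.sum_le_sum fun i _ => h i).trans ?_)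
  simp [mul_assoc]

/-- Simple tabulation concentration with arbitrary value functions. -/
lemma tt_simple {S R : Type*} [Fintype S] [DecidableEq S] [Fintype R] [AddCommGroup R] (δ : ℝ) (hδ : 0 < δ)
    (hδ1 : δ ≤ 1) (d : ℕ) :
    ∀ (w : (Fin d → S) → R → ℝ), (∀ y z, 0 ≤ w y z ∧ w y z ≤ 1) →
      ∀ l : ℝ, l = ∑ y, (∑ z, w y z) / (Fintype.card R : ℝ) →
      ttCnt (fun h : Fin d → S → R =>
        ¬ |∑ y, w y (∑ i, h i (y i)) - l| ≤
          (3 * (1 + Real.log (1 / δ))) ^ d * Real.sqrt (max l 1)) ≤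
        ((Fintype.card S * Fintype.card R + 2) ^ d * δ) * Fintype.card (Fin d → S → R) := by
  have hR : (0 : ℝ) < Fintype.card R := by exact_mod_cast Fintype.card_pos
  have hlog : 0 ≤ Real.log (1 / δ) := Real.log_nonneg (by rw [le_div_iff₀ hδ]; linarith)
  induction d with
  | zero =>
    intro w hw l hl
    have : ∀ h : Fin 0 → S → R, |∑ y, w y (∑ i, h i (y i)) - l| ≤
          (3 * (1 + Real.log (1 / δ))) ^ 0 * Real.sqrt (max l 1) := by
      intro h
      have hs : 1 ≤ Real.sqrt (max l 1) := Real.one_le_sqrt.2 (le_max_right _ _)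
      simp only [Finset.univ_unique, Finset.sum_singleton] at hl ⊢
      have hl0 : 0 ≤ l := by
        rw [hl]; exact div_nonneg (Finset.sum_nonneg fun z _ => (hw _ z).1) hR.le
      have hl1 : l ≤ 1 := by
        rw [hl, div_le_one hR]
        calc _ ≤ ∑ z : R, (1 : ℝ) := Finset.sum_le_sum fun z _ => (hw _ z).2
          _ = _ := by simp
      have h0 := hw default (∑ i, h i ((default : Fin 0 → S) i))
      rw [pow_zero, one_mul]
      refine le_trans ?_ hs
      rw [abs_le]; constructor <;> linarith [h0.1, h0.2]
    refine le_trans (le_of_eq ?_) (by positivity : (0 : ℝ) ≤ _)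
    rw [ttCnt_sum]
    exact Finset.sum_eq_zero fun h _ => if_neg (not_not.2 (this h))
  | succ d ih =>
    intro w hw l hl
    set L := (3 * (1 + Real.log (1 / δ))) ^ d with hLdef
    have hL : 1 ≤ L := one_le_pow₀ (by linarith)
    let lam : S → ℝ := fun a => ∑ y : Fin d → S, (∑ z, w (Fin.cons a y) z) / (Fintype.card R : ℝ)
    let X : (Fin d → S → R) → S → R → ℝ := fun h a z =>
      ∑ y : Fin d → S, w (Fin.cons a y) (z + ∑ i, h i (y i))
    have hsplit : ∀ F : (Fin (d+1) → S) → ℝ, ∑ y, F y = ∑ a, ∑ y : Fin d → S, F (Fin.cons a y) := by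
      intro F
      rw [← (Fin.consEquiv (fun _ => S)).sum_comp, Fintype.sum_prod_type]
      rfl
    have hllam : ∑ a, lam a = l := by rw [hl, hsplit]
    have hlam0 : ∀ a, 0 ≤ lam a := fun a => Finset.sum_nonneg fun y _ =>
      div_nonneg (Finset.sum_nonneg fun z _ => (hw _ z).1) hR.le
    have hgood := tt_union (A := Fin d → S → R) (I := S × R)
      (fun i h => |X h i.1 i.2 - lam i.1| ≤ L * Real.sqrt (max (lam i.1) 1))
      ((Fintype.card S * Fintype.card R + 2) ^ d * δ) (by
        rintro ⟨a, z⟩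
        refine ih (fun y r => w (Fin.cons a y) (z + r)) (fun y r => hw _ _) (lam a) ?_
        refine Finset.sum_congr rfl fun y _ => ?_
        congr 1
        exact (Equiv.sum_comp (Equiv.addLeft z) (fun r => w (Fin.cons a y) r)).symm)
    have hmain := tt_fub (A := Fin d → S → R) (B := S → R)
      (fun h f => 3 * (1 + Real.log (1 / δ)) * L * Real.sqrt (max l 1) <
        |∑ a, X h a (f a) - l|) _ _ (2 * δ) (by positivity) hgood (by
        intro h hh
        refine tt_step (X h) lam l L δ hL hδ ?_ hlam0 hllam ?_ ?_
        · exact fun a z => Finset.sum_nonneg fun y _ => (hw _ _).1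
        · rw [← hllam]
          refine Finset.sum_congr rfl fun a _ => ?_
          simp only [X, lam]
          rw [← Finset.sum_div]
          congr 1
          rw [Finset.sum_comm]
          refine Finset.sum_congr rfl fun y _ => ?_
          exact (Equiv.sum_comp (Equiv.addRight (∑ i, h i (y i))) (fun r => w (Fin.cons a y) r))
        · exact fun a z => hh (a, z))
    let e : (Fin d → S → R) × (S → R) ≃ (Fin (d+1) → S → R) :=
      (Equiv.prodComm _ _).trans (Fin.consEquiv (fun _ => S → R))
    have hcard : ttCnt (fun h : Fin (d+1) → S → R =>
        ¬ |∑ y, w y (∑ i, h i (y i)) - l| ≤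
          (3 * (1 + Real.log (1 / δ))) ^ (d+1) * Real.sqrt (max l 1)) =
        ttCnt (fun x : (Fin d → S → R) × (S → R) =>
          3 * (1 + Real.log (1 / δ)) * L * Real.sqrt (max l 1) <
        |∑ a, X x.1 a (x.2 a) - l|) := by
      symm
      apply ttCnt_equiv e
      rintro ⟨h, f⟩
      rw [not_le]
      have h1 : ∑ y, w y (∑ i, e (h, f) i (y i)) = ∑ a, X h a (f a) := by
        rw [hsplit]
        refine Finset.sum_congr rfl fun a _ => Finset.sum_congr rfl fun y _ => ?_
        rw [Fin.sum_univ_succ]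
        rfl
      rw [h1, pow_succ', hLdef]
    rw [hcard]
    refine hmain.trans ?_
    have hc2 : (Fintype.card (Fin d → S → R) * Fintype.card (S → R) : ℝ) =
        Fintype.card (Fin (d+1) → S → R) := by
      rw [← Fintype.card_congr e, Fintype.card_prod]; push_cast; rfl
    rw [hc2]
    gcongr
    rw [Fintype.card_prod]
    push_cast
    set N : ℝ := (Fintype.card S : ℝ) * Fintype.card R
    have hN : 0 ≤ N := by positivity
    have : 1 ≤ (N + 2) ^ d := one_le_pow₀ (by linarith)
    have h12 : N * (N + 2) ^ d + 2 ≤ (N + 2) ^ (d + 1) := by rw [pow_succ]; nlinarith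
    calc N * ((N + 2) ^ d * δ) + 2 * δ = (N * (N + 2) ^ d + 2) * δ := by ring
      _ ≤ _ := by gcongr

/-- Twisted tabulation, with explicit parameters. -/
lemma tt_twisted {S R : Type*} [Fintype S] [DecidableEq S] [AddCommGroup S] [Fintype R] [AddCommGroup R]
    (k : ℕ) (δ : ℝ) (hδ : 0 < δ) (hδ1 : δ ≤ 1)
    (v : S × (Fin k → S) → R → ℝ) (hv : ∀ x y, 0 ≤ v x y ∧ v x y ≤ 1) (μ : ℝ)
    (hμ : μ = ∑ x : S × (Fin k → S), (∑ y : R, v x y) / (Fintype.card (R) : ℝ)) :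
    ttCnt (fun ω : (Fin k → S → S × R) × (S → R) =>
        ¬ |(∑ x : S × (Fin k → S), v x ((∑ i, ω.1 i (x.2 i)).2 + ω.2 (x.1 + (∑ i, ω.1 i (x.2 i)).1))) - μ| ≤
          (3 * (1 + Real.log (1 / δ))) ^ (k + 1) * Real.sqrt (max μ 1)) ≤
      ((Fintype.card (S) * Fintype.card (S × R) + 2) ^ (k + 1) * δ) *
        Fintype.card ((Fin k → S → S × R) × (S → R)) := by
  have hR : (0 : ℝ) < Fintype.card (R) := by exact_mod_cast Fintype.card_pos
  have hS : (0 : ℝ) < Fintype.card (S) := by exact_mod_cast Fintype.card_pos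
  have hS1 : (1 : ℝ) ≤ Fintype.card (S) := by exact_mod_cast Fintype.card_pos
  have hlog : 0 ≤ Real.log (1 / δ) := Real.log_nonneg (by rw [le_div_iff₀ hδ]; linarith)
  have hμ0 : 0 ≤ μ := by
    rw [hμ]; exact Finset.sum_nonneg fun x _ =>
      div_nonneg (Finset.sum_nonneg fun z _ => (hv _ z).1) hR.le
  set L := (3 * (1 + Real.log (1 / δ))) ^ k with hLdef
  have hL : 1 ≤ L := one_le_pow₀ (by linarith)
  let lam : S → ℝ := fun _ => μ / Fintype.card (S)
  let X : (Fin k → S → S × R) → S → R → ℝ := fun h a z =>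
    ∑ y : Fin k → S, v (a - (∑ i, h i (y i)).1, y) ((∑ i, h i (y i)).2 + z)
  -- reindexing: for each tail, heads against twisted heads
  have hre : ∀ (h : Fin k → S → S × R) (F : S → (Fin k → S) → S → ℝ),
      ∑ x : S × (Fin k → S), F x.1 x.2 (x.1 + (∑ i, h i (x.2 i)).1) =
      ∑ a, ∑ y : Fin k → S, F (a - (∑ i, h i (y i)).1) y a := by
    intro h F
    rw [Fintype.sum_prod_type, Finset.sum_comm]
    rw [Finset.sum_comm (s := (univ : Finset (S)))]
    refine Finset.sum_congr rfl fun y _ => ?_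
    rw [← Equiv.sum_comp (Equiv.subRight (∑ i, h i (y i)).1)]
    refine Finset.sum_congr rfl fun a _ => ?_
    simp
  have hmeanX : ∀ (a : S) (z : R), lam a = ∑ y : Fin k → S,
      (∑ r : S × R, v (a - r.1, y) (r.2 + z)) / (Fintype.card (S × R) : ℝ) := by
    intro a z
    simp only [lam]
    rw [← Finset.sum_div, hμ, ← Finset.sum_div, div_div, Fintype.card_prod (S) (R)]
    push_cast
    rw [mul_comm (Fintype.card (S) : ℝ)]
    congr 1
    rw [Fintype.sum_prod_type, Finset.sum_comm]
    refine Finset.sum_congr rfl fun y _ => ?_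
    rw [Fintype.sum_prod_type (γ := ℝ) (α₁ := S) (α₂ := R)]
    rw [← Equiv.sum_comp (Equiv.subLeft a)]
    refine Finset.sum_congr rfl fun t _ => ?_
    exact (Equiv.sum_comp (Equiv.addRight z) (fun r => v (a - t, y) r)).symm
  have hsim : ∀ (a : S) (z : R), ttCnt (fun h : Fin k → S → S × R =>
      ¬ |X h a z - lam a| ≤ L * Real.sqrt (max (lam a) 1)) ≤
      ((Fintype.card S * Fintype.card (S × R) + 2) ^ k * δ) *
        Fintype.card (Fin k → S → S × R) := by
    intro a z
    have := tt_simple (S := S) (R := S × R) δ hδ hδ1 k (fun y r => v (a - r.1, y) (r.2 + z))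
      (fun y r => hv _ _) (lam a) (hmeanX a z)
    exact this
  have hgood := tt_union (A := Fin k → S → S × R) (I := S × R)
    (fun i h => |X h i.1 i.2 - lam i.1| ≤ L * Real.sqrt (max (lam i.1) 1))
    ((Fintype.card (S) * Fintype.card (S × R) + 2) ^ k * δ) (by
      rintro ⟨a, z⟩
      exact hsim a z)
  have hmain := tt_fub (A := Fin k → S → S × R) (B := S → R)
    (fun h f => 3 * (1 + Real.log (1 / δ)) * L * Real.sqrt (max μ 1) <
      |∑ a, X h a (f a) - μ|) _ _ (2 * δ) (by positivity) hgood (by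
      intro h hh
      refine tt_step (X h) lam μ L δ hL hδ ?_ ?_ ?_ ?_ ?_
      · exact fun a z => Finset.sum_nonneg fun y _ => (hv _ _).1
      · exact fun a => div_nonneg hμ0 hS.le
      · simp only [lam, sum_const, card_univ, nsmul_eq_mul]
        field_simp
      · rw [hμ, ← Finset.sum_div, ← Finset.sum_div]
        congr 1
        rw [hre h (fun x0 y _ => ∑ z, v (x0, y) z)]
        refine Finset.sum_congr rfl fun a _ => ?_
        simp only [X]
        rw [Finset.sum_comm]
        refine Finset.sum_congr rfl fun y _ => ?_
        exact (Equiv.sum_comp (Equiv.addLeft (∑ i, h i (y i)).2)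
          (fun r => v (a - (∑ i, h i (y i)).1, y) r))
      · exact fun a z => hh (a, z))
  have hset : ttCnt (fun ω : (Fin k → S → S × R) × (S → R) =>
        ¬ |(∑ x : S × (Fin k → S), v x ((∑ i, ω.1 i (x.2 i)).2 + ω.2 (x.1 + (∑ i, ω.1 i (x.2 i)).1))) - μ| ≤
          (3 * (1 + Real.log (1 / δ))) ^ (k + 1) * Real.sqrt (max μ 1)) =
      ttCnt (fun x : (Fin k → S → S × R) × (S → R) =>
          3 * (1 + Real.log (1 / δ)) * L * Real.sqrt (max μ 1) <
        |∑ a, X x.1 a (x.2 a) - μ|) := by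
    apply ttCnt_equiv (Equiv.refl _)
    rintro ⟨h, f⟩
    rw [Equiv.refl_apply]
    rw [not_le]
    have h1 : ∑ x : S × (Fin k → S), v x ((∑ i, h i (x.2 i)).2 + f (x.1 + (∑ i, h i (x.2 i)).1)) = ∑ a, X h a (f a) :=
      hre h (fun x0 y a => v (x0, y) ((∑ i, h i (y i)).2 + f a))
    rw [h1, pow_succ', hLdef]
  rw [hset]
  refine hmain.trans ?_
  rw [Fintype.card_prod (Fin k → S → S × R)]
  push_cast
  gcongr
  set N0 : ℝ := (Fintype.card (S × R) : ℝ) with hN0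
  have hN00 : 0 ≤ N0 := by positivity
  set N : ℝ := (Fintype.card (S) : ℝ) * N0
  have hNN : N0 ≤ N := by simp only [N]; nlinarith
  have : 1 ≤ (N + 2) ^ k := one_le_pow₀ (by linarith)
  have h12 : N0 * (N + 2) ^ k + 2 ≤ (N + 2) ^ (k + 1) := by rw [pow_succ]; nlinarith
  calc N0 * ((N + 2) ^ k * δ) + 2 * δ = (N0 * (N + 2) ^ k + 2) * δ := by ring
    _ ≤ _ := by gcongr

/-- Concentration for twisted tabulation at large expectation
(Theorem 5, equation (8)): for constants `c = k+1 ≥ 2` and `γ > 0` there are constants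
`C` and `K` such that for a random twisted tabulation function `h : [u] → [u]`
(`u = |Σ|^c`) and arbitrary fixed value functions `v_x : [u] → [0,1]`, with
`V = Σ_x v_x(h(x))` and `μ = Σ_x E[v_x(U)]` (`U` uniform in `[u]`): if `μ ≥ √|Σ|`,
then with probability at least `1 − u^{−γ}` we have `|V − μ| ≤ C·√μ·(log u)^K`. -/
theorem twisted_tabulation_concentration (k : ℕ) (hk : 1 ≤ k) (γ : ℝ) (hγ : 0 < γ) :
    ∃ C : ℝ, ∃ K : ℕ,
      ∀ (s : ℕ) (v : Key s k → Key s k → ℝ),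
        (∀ x y, 0 ≤ v x y ∧ v x y ≤ 1) →
        ∀ μ : ℝ,
          μ = ∑ x : Key s k, (∑ y : Key s k, v x y) / (Fintype.card (Key s k) : ℝ) →
          Real.sqrt ((2 : ℝ) ^ s) ≤ μ →
          1 - (Fintype.card (Key s k) : ℝ) ^ (-γ) ≤
            Pr (fun ω : (Fin k → Bits s → Bits s × Key s k) × (Bits s → Key s k) =>
              |(∑ x : Key s k, v x (twistedTab ω x)) - μ| ≤
                C * Real.sqrt μ * Real.log (Fintype.card (Key s k)) ^ K) := by
  refine ⟨(3 * (1 + (γ + 3 * (k + 1)))) ^ (k + 1), k + 1, ?_⟩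
  intro s v hv μ hμ hμs
  set u : ℝ := (Fintype.card (Key s k) : ℝ) with hu
  have hcS : (Fintype.card (Bits s) : ℝ) = 2 ^ s := by simp [Bits, ZMod.card]
  have hcu : u = (2 ^ s) ^ (k + 1) := by
    rw [hu, Fintype.card_prod (Bits s) (Fin k → Bits s), Nat.cast_mul, hcS,
      Fintype.card_fun (α := Fin k) (β := Bits s), Nat.cast_pow, hcS, Fintype.card_fin, pow_succ']
  rcases Nat.eq_zero_or_pos s with hs | hs
  · have hu1 : u = 1 := by rw [hcu, hs]; simp
    rw [hu1, Real.one_rpow, sub_self]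
    unfold Pr
    positivity
  have hσ : (2 : ℝ) ≤ 2 ^ s := by
    calc (2 : ℝ) = 2 ^ 1 := by norm_num
      _ ≤ 2 ^ s := pow_le_pow_right₀ (by norm_num) hs
  have hu4 : 4 ≤ u := by
    rw [hcu]
    calc (4 : ℝ) = 2 ^ 2 := by norm_num
      _ ≤ (2 ^ s) ^ 2 := by gcongr
      _ ≤ _ := pow_le_pow_right₀ (by linarith) (by omega)
  have hu0 : 0 < u := by linarith
  have hlog1 : 1 ≤ Real.log u := by
    rw [Real.le_log_iff_exp_le hu0]
    linarith [Real.exp_one_lt_d9]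
  have hμ1 : 1 ≤ μ := by
    refine le_trans ?_ hμs
    exact Real.one_le_sqrt.2 (by linarith)
  set E : ℝ := γ + 3 * (k + 1) with hE
  have hE0 : 0 < E := by positivity
  set δ : ℝ := u ^ (-E) with hδd
  have hδ : 0 < δ := Real.rpow_pos_of_pos hu0 _
  have hδ1 : δ ≤ 1 := Real.rpow_le_one_of_one_le_of_nonpos (by linarith) (by linarith)
  have hlogδ : Real.log (1 / δ) = E * Real.log u := by
    rw [one_div, Real.log_inv, hδd, Real.log_rpow hu0]; ring
  have key := tt_twisted (S := Bits s) (R := Key s k) k δ hδ hδ1 v hv μ hμ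
  rw [hlogδ, max_eq_left hμ1] at key
  have hΩ : (0 : ℝ) < Fintype.card
      ((Fin k → Bits s → Bits s × Key s k) × (Bits s → Key s k)) := by
    exact_mod_cast Fintype.card_pos
  have hN : (Fintype.card (Bits s) : ℝ) * Fintype.card (Bits s × Key s k) + 2 ≤ u ^ 3 := by
    rw [Fintype.card_prod (Bits s) (Key s k), Nat.cast_mul, hcS, ← hu]
    have : (2 ^ s : ℝ) * (2 ^ s) ≤ u := by
      rw [hcu]
      calc (2 ^ s : ℝ) * (2 ^ s) = (2 ^ s) ^ 2 := by ring
        _ ≤ _ := pow_le_pow_right₀ (by linarith) (by omega)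
    have h2 : (2 ^ s : ℝ) * (2 ^ s * u) ≤ u * u := by
      rw [← mul_assoc]; gcongr
    have h3 : 4 * (u * u) ≤ u ^ 3 := by
      calc 4 * (u * u) ≤ u * (u * u) := by gcongr
        _ = u ^ 3 := by ring
    nlinarith
  have hp : ((Fintype.card (Bits s) : ℝ) * Fintype.card (Bits s × Key s k) + 2) ^ (k + 1) * δ
      ≤ u ^ (-γ) := by
    calc _ ≤ (u ^ 3) ^ (k + 1) * δ := by gcongr
      _ = u ^ (-γ) := by
        rw [← pow_mul, ← Real.rpow_natCast, hδd, ← Real.rpow_add hu0]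
        congr 1
        rw [hE]; push_cast; ring
  have hbad : ttCnt
      (fun ω : (Fin k → Bits s → Bits s × Key s k) × (Bits s → Key s k) =>
      ¬ |(∑ x : Key s k, v x (twistedTab ω x)) - μ| ≤
          (3 * (1 + E * Real.log u)) ^ (k + 1) * Real.sqrt μ) ≤ u ^ (-γ) * Fintype.card
      ((Fin k → Bits s → Bits s × Key s k) × (Bits s → Key s k)) :=
    key.trans (mul_le_mul_of_nonneg_right hp hΩ.le)
  have hnot := ttCnt_not
    (fun ω : (Fin k → Bits s → Bits s × Key s k) × (Bits s → Key s k) =>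
      |(∑ x : Key s k, v x (twistedTab ω x)) - μ| ≤
          (3 * (1 + E * Real.log u)) ^ (k + 1) * Real.sqrt μ)
  have hsub := ttCnt_mono
    (P := fun ω : (Fin k → Bits s → Bits s × Key s k) × (Bits s → Key s k) =>
      |(∑ x : Key s k, v x (twistedTab ω x)) - μ| ≤
          (3 * (1 + E * Real.log u)) ^ (k + 1) * Real.sqrt μ)
    (Q := fun ω : (Fin k → Bits s → Bits s × Key s k) × (Bits s → Key s k) =>
      |(∑ x : Key s k, v x (twistedTab ω x)) - μ| ≤
          (3 * (1 + E)) ^ (k + 1) * Real.sqrt μ * Real.log u ^ (k + 1)) (by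
    intro ω hω
    refine hω.trans ?_
    have : (3 * (1 + E * Real.log u)) ^ (k + 1) ≤ (3 * (1 + E) * Real.log u) ^ (k + 1) := by
      have h0 : 0 ≤ E * Real.log u := by positivity
      gcongr ?_ ^ _
      nlinarith
    calc _ ≤ (3 * (1 + E) * Real.log u) ^ (k + 1) * Real.sqrt μ := by gcongr
      _ = _ := by rw [mul_pow]; ring)
  have hfin : (1 - u ^ (-γ)) * Fintype.card
      ((Fin k → Bits s → Bits s × Key s k) × (Bits s → Key s k)) ≤ _ :=
    le_trans (by linarith) hsub
  unfold Pr
  rw [le_div_iff₀ hΩ]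
  exact hfin
end

section
/- Twisted tabulation is ε-minwise independent with bias depending only on the universe (Theorem 6): for every constant c ≥ 2 there exists a constant C such that the following holds. Let u = |Σ|^c, let h : Σ^c → [m] be a random twisted tabulation hash function with m ≥ n·u^{1/c} (m a power of two), let S ⊆ Σ^c be a set of n keys and q ∈ S. Then |Pr[h(q) = min_{x∈S} h(x)] − 1/n| ≤ ε/n where ε = C·(log u)²/u^{1/c}. -/
open scoped Classical
open Finset

set_option synthInstance.maxSize 1024
set_option synthInstance.maxHeartbeats 1000000
set_option maxHeartbeats 1000000

/-- The numerical value in `[2^n]` of a bit string (used to compare hash values). -/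
def bitsToNat {n : ℕ} (v : Bits n) : ℕ :=
  ∑ i : Fin n, (v i).val * 2 ^ (i : ℕ)

namespace TTM

/-! ### Bit strings -/

lemma val_succ {n : ℕ} (v : Bits (n+1)) :
    bitsToNat v = (v 0).val + 2 * bitsToNat (fun i : Fin n => v i.succ) := by
  unfold bitsToNat
  rw [Fin.sum_univ_succ, Finset.mul_sum]
  simp only [Fin.val_zero, pow_zero, mul_one, Fin.val_succ, pow_succ]
  congr 1
  refine Finset.sum_congr rfl fun i _ => by ring

lemma val_lt {n : ℕ} (v : Bits n) : bitsToNat v < 2 ^ n := by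
  induction n with
  | zero => simp [bitsToNat]
  | succ n ih =>
    rw [val_succ]
    have := ih (fun i : Fin n => v i.succ)
    have h2 : (v 0).val < 2 := ZMod.val_lt _
    rw [pow_succ]; omega

lemma val_inj {n : ℕ} : Function.Injective (bitsToNat (n := n)) := by
  induction n with
  | zero => intro a b _; exact Subsingleton.elim _ _
  | succ n ih =>
    intro a b h
    rw [val_succ, val_succ] at h
    have h1 : (a 0).val < 2 := ZMod.val_lt _
    have h2 : (b 0).val < 2 := ZMod.val_lt _
    have h3 : (a 0).val = (b 0).val := by omega
    have h4 := ih (a₁ := fun i : Fin n => a i.succ) (a₂ := fun i : Fin n => b i.succ) (by omega)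
    funext i
    refine Fin.cases ?_ (fun j => ?_) i
    · exact ZMod.val_injective _ h3
    · exact congrFun h4 j

lemma val_lt_iff {n : ℕ} (v : Bits n) (b : ℕ) :
    bitsToNat v < 2 ^ b ↔ ∀ i : Fin n, b ≤ (i : ℕ) → v i = 0 := by
  induction n generalizing b with
  | zero => simp [bitsToNat]
  | succ n ih =>
    rw [val_succ, Fin.forall_fin_succ]
    have h1 : (v 0).val < 2 := ZMod.val_lt _
    cases b with
    | zero =>
      have := ih (fun i : Fin n => v i.succ) 0
      simp only [pow_zero, Nat.lt_one_iff] at this ⊢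
      simp only [Nat.add_eq_zero_iff, ZMod.val_eq_zero, Nat.mul_eq_zero, this]
      simp
    | succ b =>
      have := ih (fun i : Fin n => v i.succ) b
      have e : (v 0).val + 2 * bitsToNat (fun i : Fin n => v i.succ) < 2 ^ (b+1) ↔
          bitsToNat (fun i : Fin n => v i.succ) < 2 ^ b := by
        rw [pow_succ]; omega
      rw [e, this]
      simp

lemma card_bits (n : ℕ) : Fintype.card (Bits n) = 2 ^ n := by
  simp [Bits, ZMod.card]

lemma image_val (n : ℕ) : (Finset.univ : Finset (Bits n)).image bitsToNat = Finset.range (2^n) := by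
  apply Finset.eq_of_subset_of_card_le
  · intro x hx
    simp only [Finset.mem_image, Finset.mem_univ, true_and] at hx
    obtain ⟨v, rfl⟩ := hx
    exact Finset.mem_range.2 (val_lt v)
  · rw [Finset.card_image_of_injective _ val_inj, Finset.card_univ, card_bits, Finset.card_range]

lemma sum_val {n : ℕ} (f : ℕ → ℝ) : ∑ v : Bits n, f (bitsToNat v) = ∑ y ∈ Finset.range (2^n), f y := by
  rw [← image_val, Finset.sum_image (fun a _ b _ h => val_inj h)]

lemma card_val_lt {n : ℕ} (y : ℕ) (hy : y ≤ 2 ^ n) :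
    (Finset.univ.filter (fun v : Bits n => bitsToNat v < y)).card = y := by
  rw [← Finset.card_image_of_injective _ (val_inj (n := n))]
  have : (Finset.univ.filter (fun v : Bits n => bitsToNat v < y)).image bitsToNat
      = Finset.range y := by
    ext a
    simp only [Finset.mem_image, Finset.mem_filter, Finset.mem_univ, true_and, Finset.mem_range]
    constructor
    · rintro ⟨v, h, rfl⟩; exact h
    · intro h
      have : a ∈ (Finset.univ : Finset (Bits n)).image bitsToNat := by
        rw [image_val]; exact Finset.mem_range.2 (by omega)
      simp only [Finset.mem_image, Finset.mem_univ, true_and] at this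
      obtain ⟨v, rfl⟩ := this
      exact ⟨v, h, rfl⟩
  rw [this, Finset.card_range]

lemma val_sub_lt {n b : ℕ} {v w : Bits n} (hv : bitsToNat v < 2^b) (hw : bitsToNat w < 2^b) :
    bitsToNat (v - w) < 2^b := by
  rw [val_lt_iff] at *
  intro i hi
  simp [hv i hi, hw i hi]

/-! ### Hash values -/

variable {s r k : ℕ}

/-- the twisted group together with the hash value of the tail. -/
def psi (ω : Fin k → Bits s → Bits s × Bits r) (x : Key s k) : Bits s × Bits r :=
  (x.1, 0) + ∑ i, ω i (x.2 i)

lemma twistedTab_eq (ω : (Fin k → Bits s → Bits s × Bits r) × (Bits s → Bits r)) (x : Key s k) :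
    twistedTab ω x = (psi ω.1 x).2 + ω.2 (psi ω.1 x).1 := by
  simp [twistedTab, psi]

/-- elementary shift -/
def upd (i : Fin k) (a : Bits s) (v : Bits s × Bits r) : Fin k → Bits s → Bits s × Bits r :=
  Pi.single i (Pi.single a v)

lemma psi_upd (ω : Fin k → Bits s → Bits s × Bits r) (x : Key s k) (i : Fin k) (a : Bits s)
    (v : Bits s × Bits r) :
    psi (ω + upd i a v) x = psi ω x + (if x.2 i = a then v else 0) := by
  unfold psi
  simp only [Pi.add_apply, Finset.sum_add_distrib, add_assoc]
  congr 2
  rw [Finset.sum_eq_single i]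
  · simp only [upd, Pi.single_eq_same, Pi.single_apply]
  · intro j _ hj
    simp [upd, Pi.single_eq_of_ne hj]
  · simp

lemma shift (x x0 : Key s k) (i : Fin k) (hne : x0.2 i ≠ x.2 i)
    (F : (Fin k → Bits s → Bits s × Bits r) → ℝ)
    (hF : ∀ ω v, F (ω + upd i (x.2 i) v) = F ω) (f : Bits s × Bits r → ℝ) :
    (∑ ω, F ω * f (psi ω x - psi ω x0)) * Fintype.card (Bits s × Bits r)
      = (∑ ω, F ω) * ∑ v, f v := by
  have h1 : ∀ v : Bits s × Bits r, ∑ ω, F ω * f (psi ω x - psi ω x0)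
      = ∑ ω, F ω * f (psi ω x - psi ω x0 + v) := by
    intro v
    rw [← Equiv.sum_comp (Equiv.addRight (upd i (x.2 i) v))]
    refine Finset.sum_congr rfl fun ω _ => ?_
    simp only [Equiv.coe_addRight]
    rw [hF, psi_upd, psi_upd, if_pos rfl, if_neg hne]
    congr 2
    abel
  have h2 : (∑ ω, F ω * f (psi ω x - psi ω x0)) * Fintype.card (Bits s × Bits r)
      = ∑ v : Bits s × Bits r, ∑ ω, F ω * f (psi ω x - psi ω x0 + v) := by
    rw [← Finset.sum_congr rfl (fun v _ => h1 v), Finset.sum_const, Finset.card_univ, nsmul_eq_mul,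
      mul_comm]
  rw [h2, Finset.sum_comm, Finset.sum_mul]
  refine Finset.sum_congr rfl fun ω _ => ?_
  rw [← Finset.mul_sum]
  congr 1
  exact Equiv.sum_comp (Equiv.addLeft (psi ω x - psi ω x0)) f

/-- averages -/
noncomputable def av {Ω : Type*} [Fintype Ω] (f : Ω → ℝ) : ℝ := (∑ ω, f ω) / Fintype.card Ω

section av
variable {Ω : Type*} [Fintype Ω]

lemma av_mono {f g : Ω → ℝ} (h : ∀ ω, f ω ≤ g ω) : av f ≤ av g :=
  div_le_div_of_nonneg_right (Finset.sum_le_sum fun ω _ => h ω) (by positivity)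

lemma av_add (f g : Ω → ℝ) : av (fun ω => f ω + g ω) = av f + av g := by
  simp [av, Finset.sum_add_distrib, add_div]

lemma av_sub (f g : Ω → ℝ) : av (fun ω => f ω - g ω) = av f - av g := by
  simp [av, Finset.sum_sub_distrib, sub_div]

lemma av_sum {ι : Type*} (A : Finset ι) (f : ι → Ω → ℝ) :
    av (fun ω => ∑ i ∈ A, f i ω) = ∑ i ∈ A, av (f i) := by
  simp only [av]; rw [Finset.sum_comm, Finset.sum_div]

lemma av_mul (c : ℝ) (f : Ω → ℝ) : av (fun ω => c * f ω) = c * av f := by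
  simp only [av]; rw [← Finset.mul_sum, mul_div_assoc]

lemma av_const [Nonempty Ω] (c : ℝ) : av (fun _ : Ω => c) = c := by
  simp [av]

lemma av_abs (f : Ω → ℝ) : |av f| ≤ av (fun ω => |f ω|) := by
  simp only [av]
  rw [abs_div, abs_of_nonneg (a := (Fintype.card Ω : ℝ)) (by positivity)]
  exact div_le_div_of_nonneg_right (Finset.abs_sum_le_sum_abs _ _) (by positivity)

lemma av_nonneg {f : Ω → ℝ} (h : ∀ ω, 0 ≤ f ω) : 0 ≤ av f :=
  div_nonneg (Finset.sum_nonneg fun ω _ => h ω) (by positivity)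
end av

lemma av_pair (x x0 : Key s k) (hne : x.2 ≠ x0.2) (f : Bits s × Bits r → ℝ) :
    av (fun ω => f (psi ω x - psi ω x0)) = av f := by
  obtain ⟨i, hi⟩ := Function.ne_iff.1 hne
  have := shift x x0 i (Ne.symm hi) (fun _ => 1) (fun _ _ => rfl) f
  simp only [one_mul, Finset.sum_const, Finset.card_univ, nsmul_eq_mul, mul_one] at this
  unfold av
  rw [div_eq_div_iff (by positivity) (by positivity), this, mul_comm]

/-! ### The moment bound -/

def fresh (x : Key s k) (L : List (Key s k)) : Prop := ∃ i, ∀ x' ∈ L, x'.2 i ≠ x.2 i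

noncomputable def cnt (x0 : Key s k) (T : Finset (Key s k)) : ℕ → List (Key s k) → ℕ
  | 0, _ => 1
  | l+1, L => ∑ x ∈ T.filter (fun x => fresh x (x0 :: L)), cnt x0 T l (x :: L)

lemma fresh_card (x0 : Key s k) (T : Finset (Key s k))
    (hT : ∀ x ∈ T, ∀ x' ∈ T, x.2 = x'.2 → x = x') (L : List (Key s k)) :
    T.card ≤ (T.filter (fun x => fresh x (x0 :: L))).card + (L.length + 1) ^ k := by
  rw [← Finset.card_filter_add_card_filter_not (s := T) (fun x => fresh x (x0 :: L))]
  refine Nat.add_le_add_left ?_ _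
  have h1 : ((T.filter (fun x => ¬ fresh x (x0 :: L))).image (fun x => x.2)).card
      = (T.filter (fun x => ¬ fresh x (x0 :: L))).card := by
    apply Finset.card_image_of_injOn
    intro a ha b hb h
    rw [Finset.mem_coe, Finset.mem_filter] at ha hb
    exact hT a ha.1 b hb.1 h
  rw [← h1]
  have h2 : (T.filter (fun x => ¬ fresh x (x0 :: L))).image (fun x => x.2) ⊆
      Fintype.piFinset (fun i : Fin k => ((x0 :: L).map (fun x => x.2 i)).toFinset) := by
    intro t ht
    simp only [Finset.mem_image, Finset.mem_filter] at ht
    obtain ⟨x, ⟨_, hx⟩, rfl⟩ := ht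
    rw [Fintype.mem_piFinset]
    intro i
    rw [List.mem_toFinset, List.mem_map]
    unfold fresh at hx
    push Not at hx
    exact hx i
  refine (Finset.card_le_card h2).trans ?_
  rw [Fintype.card_piFinset]
  refine (Finset.prod_le_pow_card _ _ (L.length + 1) ?_).trans (by simp)
  intro i _
  refine (List.toFinset_card_le _).trans (by simp)

lemma cnt_lower (x0 : Key s k) (T : Finset (Key s k))
    (hT : ∀ x ∈ T, ∀ x' ∈ T, x.2 = x'.2 → x = x') (l : ℕ) (L : List (Key s k)) :
    (T.card - (L.length + l + 1) ^ k) ^ l ≤ cnt x0 T l L := by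
  induction l generalizing L with
  | zero => simp [cnt]
  | succ l ih =>
    rw [cnt]
    have h1 := Finset.card_nsmul_le_sum (T.filter (fun x => fresh x (x0 :: L)))
      (fun x => cnt x0 T l (x :: L)) ((T.card - (L.length + 1 + l + 1) ^ k) ^ l)
      (fun x _ => ih (x :: L))
    refine le_trans ?_ h1
    have h2 := fresh_card x0 T hT L
    have h3 : (L.length + 1) ^ k ≤ (L.length + (l+1) + 1) ^ k := Nat.pow_le_pow_left (by omega) k
    rw [pow_succ, mul_comm, smul_eq_mul]
    have e : L.length + 1 + l + 1 = L.length + (l+1) + 1 := by ring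
    rw [e]
    exact Nat.mul_le_mul_right _ (by omega)

/-- close keys -/
noncomputable def close (S : Finset (Key s k)) (D : Finset (Bits s × Bits r)) (x0 : Key s k)
    (ω : Fin k → Bits s → Bits s × Bits r) : Finset (Key s k) :=
  S.filter (fun x => psi ω x - psi ω x0 ∈ D)

noncomputable def ind (P : Prop) : ℝ := if P then 1 else 0

lemma ind_nonneg (P : Prop) : 0 ≤ ind P := by unfold ind; split_ifs <;> norm_num
lemma ind_le_one (P : Prop) : ind P ≤ 1 := by unfold ind; split_ifs <;> norm_num
lemma ind_and (P Q : Prop) : ind (P ∧ Q) = ind Q * ind P := by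
  unfold ind; by_cases P <;> by_cases Q <;> simp [*]
lemma ind_true {P : Prop} (h : P) : ind P = 1 := if_pos h
lemma ind_false {P : Prop} (h : ¬ P) : ind P = 0 := if_neg h

lemma sum_ind_card {α : Type*} (A : Finset α) (P : α → Prop) [DecidablePred P] :
    ∑ x ∈ A, ind (P x) = ((A.filter P).card : ℝ) := by
  unfold ind; rw [← Finset.sum_boole]
  refine Finset.sum_congr rfl fun x _ => ?_
  by_cases h : P x <;> simp [h]

lemma sum_ind_mem {α : Type*} [Fintype α] (D : Finset α) :
    ∑ v, ind (v ∈ D) = (D.card : ℝ) := by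
  rw [sum_ind_card]; congr 1; congr 1; ext; simp

lemma cnt_upper (S : Finset (Key s k)) (D : Finset (Bits s × Bits r)) (x0 : Key s k)
    (l : ℕ) (L : List (Key s k)) :
    ∑ ω, ind (∀ x ∈ L, x ∈ close S D x0 ω) * (cnt x0 (close S D x0 ω) l L : ℝ)
      ≤ (S.card * (D.card / Fintype.card (Bits s × Bits r))) ^ l *
        ∑ ω, ind (∀ x ∈ L, x ∈ close S D x0 ω) := by
  induction l generalizing L with
  | zero => simp [cnt]
  | succ l ih =>
    set β : ℝ := D.card / Fintype.card (Bits s × Bits r) with hβ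
    have hβ0 : 0 ≤ β := by positivity
    have h1 : ∀ ω, ind (∀ x ∈ L, x ∈ close S D x0 ω) * (cnt x0 (close S D x0 ω) (l+1) L : ℝ)
        = ∑ x ∈ S.filter (fun x => fresh x (x0 :: L)),
          ind (∀ x' ∈ x :: L, x' ∈ close S D x0 ω) *
            (cnt x0 (close S D x0 ω) l (x :: L) : ℝ) := by
      intro ω
      rw [cnt, Nat.cast_sum, Finset.mul_sum]
      have : (close S D x0 ω).filter (fun x => fresh x (x0 :: L)) =
          (S.filter (fun x => fresh x (x0 :: L))).filter (fun x => x ∈ close S D x0 ω) := by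
        ext x; simp only [Finset.mem_filter, close]; tauto
      rw [this, Finset.sum_filter]
      refine Finset.sum_congr rfl fun x hx => ?_
      simp only [List.forall_mem_cons, ind_and]
      by_cases h : x ∈ close S D x0 ω
      · rw [if_pos h, ind_true h, mul_one]
      · rw [if_neg h, ind_false h, mul_zero, zero_mul]
    rw [Finset.sum_congr rfl (fun ω _ => h1 ω), Finset.sum_comm]
    have h2 : ∀ x ∈ S.filter (fun x => fresh x (x0 :: L)),
        ∑ ω, ind (∀ x' ∈ x :: L, x' ∈ close S D x0 ω)
          = β * ∑ ω, ind (∀ x ∈ L, x ∈ close S D x0 ω) := by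
      intro x hx
      rw [Finset.mem_filter] at hx
      obtain ⟨hxS, i, hi⟩ := hx
      have := shift x x0 i (hi x0 (by simp)) (fun ω => ind (∀ x ∈ L, x ∈ close S D x0 ω))
        (by
          intro ω v
          congr 1
          apply propext
          refine forall₂_congr fun x' hx' => ?_
          unfold close
          rw [Finset.mem_filter, Finset.mem_filter, psi_upd, psi_upd,
            if_neg (hi x0 (by simp)), if_neg (hi x' (by simp [hx']))]
          simp) (fun v => ind (v ∈ D))
      rw [sum_ind_mem] at this
      have hc : (Fintype.card (Bits s × Bits r) : ℝ) ≠ 0 := by positivity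
      rw [hβ, div_mul_eq_mul_div, eq_div_iff hc, mul_comm (D.card : ℝ), ← this]
      congr 1
      refine Finset.sum_congr rfl fun ω _ => ?_
      simp only [List.forall_mem_cons, ind_and]
      congr 2
      unfold close
      simp [hxS]
    calc _ ≤ ∑ x ∈ S.filter (fun x => fresh x (x0 :: L)), (S.card * β) ^ l *
          ∑ ω, ind (∀ x' ∈ x :: L, x' ∈ close S D x0 ω) := Finset.sum_le_sum fun x _ => ih (x :: L)
      _ = ∑ x ∈ S.filter (fun x => fresh x (x0 :: L)), (S.card * β) ^ l *
          (β * ∑ ω, ind (∀ x ∈ L, x ∈ close S D x0 ω)) :=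
          Finset.sum_congr rfl fun x hx => by rw [h2 x hx]
      _ = (S.filter (fun x => fresh x (x0 :: L))).card * ((S.card * β) ^ l *
          (β * ∑ ω, ind (∀ x ∈ L, x ∈ close S D x0 ω))) := by
          rw [Finset.sum_const, nsmul_eq_mul]
      _ ≤ S.card * ((S.card * β) ^ l *
          (β * ∑ ω, ind (∀ x ∈ L, x ∈ close S D x0 ω))) := by
          have : 0 ≤ ∑ ω, ind (∀ x ∈ L, x ∈ close S D x0 ω) :=
            Finset.sum_nonneg fun _ _ => ind_nonneg _
          refine mul_le_mul_of_nonneg_right ?_ (by positivity)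
          exact_mod_cast Finset.card_filter_le _ _
      _ = _ := by ring

lemma close_tails (S : Finset (Key s k)) (D : Finset (Bits s × Bits r)) (hD : ∀ v ∈ D, v.1 = 0)
    (x0 : Key s k) (ω : Fin k → Bits s → Bits s × Bits r) :
    ∀ x ∈ close S D x0 ω, ∀ x' ∈ close S D x0 ω, x.2 = x'.2 → x = x' := by
  intro x hx x' hx' h
  have h1 := hD _ (Finset.mem_filter.1 hx).2
  have h2 := hD _ (Finset.mem_filter.1 hx').2
  have h3 : (psi ω x).1 = (psi ω x').1 := by
    rw [Prod.fst_sub, sub_eq_zero] at h1 h2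
    rw [h1, h2]
  simp only [psi, h, Prod.fst_add, add_left_inj] at h3
  exact Prod.ext h3 h

/-- moment bound -/
lemma moment (S : Finset (Key s k)) (D : Finset (Bits s × Bits r)) (hD : ∀ v ∈ D, v.1 = 0)
    (x0 : Key s k) (l : ℕ) (t : ℕ) (g : ℝ) (hg : 0 ≤ g)
    (ht : ∀ a : ℕ, t < a → g ≤ ((a - (l+1)^k : ℕ) : ℝ)) :
    g ^ l * av (fun ω : Fin k → Bits s → Bits s × Bits r => ind (t < (close S D x0 ω).card))
      ≤ (S.card * (D.card / Fintype.card (Bits s × Bits r))) ^ l := by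
  rw [← av_mul]
  have h := cnt_upper S D x0 l []
  simp only [List.not_mem_nil, false_imp_iff, implies_true, ind_true, one_mul, Finset.sum_const,
    Finset.card_univ, nsmul_eq_mul, mul_one] at h
  unfold av
  rw [div_le_iff₀ (by positivity)]
  refine le_trans (Finset.sum_le_sum fun ω _ => ?_) h
  by_cases hc : t < (close S D x0 ω).card
  · rw [ind_true hc, mul_one]
    have h1 := cnt_lower x0 _ (close_tails S D hD x0 ω) l []
    simp only [List.length_nil, zero_add] at h1
    calc g ^ l ≤ (((close S D x0 ω).card - (l+1)^k : ℕ) : ℝ) ^ l := pow_le_pow_left₀ hg (ht _ hc) l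
      _ ≤ _ := by exact_mod_cast h1
  · rw [ind_false hc]; simp

/-! ### Covering estimates -/

section cover
variable {ι W : Type*} [Fintype W] [DecidableEq W]

lemma cover_sum (G : Finset ι) (U : ι → Finset W) :
    ∑ w, ((G.filter (fun x => w ∈ U x)).card : ℝ) = ∑ x ∈ G, ((U x).card : ℝ) := by
  rw [Finset.sum_congr rfl (fun w _ => (sum_ind_card G (fun x => w ∈ U x)).symm),
    Finset.sum_comm]
  exact Finset.sum_congr rfl fun x _ => sum_ind_mem _

lemma cover_pairs (G : Finset ι) (U : ι → Finset W) :
    ∑ w, ((G.filter (fun x => w ∈ U x)).card : ℝ) * ((G.filter (fun x => w ∈ U x)).card - 1)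
      = ∑ e ∈ G.offDiag, ((U e.1 ∩ U e.2).card : ℝ) := by
  have h : ∀ w, ((G.filter (fun x => w ∈ U x)).card : ℝ) * ((G.filter (fun x => w ∈ U x)).card - 1)
      = ∑ e ∈ G.offDiag, ind (w ∈ U e.1 ∩ U e.2) := by
    intro w
    rw [sum_ind_card]
    have e1 : G.offDiag.filter (fun e => w ∈ U e.1 ∩ U e.2)
        = (G.filter (fun x => w ∈ U x)).offDiag := by
      ext e; simp only [Finset.mem_filter, Finset.mem_offDiag, Finset.mem_inter]; tauto
    rw [e1, Finset.offDiag_card, Nat.cast_sub (Nat.le_mul_self _)]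
    push_cast; ring
  rw [Finset.sum_congr rfl (fun w _ => h w), Finset.sum_comm]
  exact Finset.sum_congr rfl fun x _ => sum_ind_mem _

lemma uncov_eq (G : Finset ι) (U : ι → Finset W)
    [DecidablePred fun w => ∀ x ∈ G, w ∉ U x] :
    ((Finset.univ.filter (fun w => ∀ x ∈ G, w ∉ U x)).card : ℝ)
      = ∑ w, ind ((G.filter (fun x => w ∈ U x)).card = 0) := by
  rw [sum_ind_card]
  congr 2
  ext w
  simp [Finset.filter_eq_empty_iff]

lemma uncov_lower (G : Finset ι) (U : ι → Finset W)
    [DecidablePred fun w => ∀ x ∈ G, w ∉ U x] :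
    (Fintype.card W : ℝ) - ∑ x ∈ G, ((U x).card : ℝ) ≤
    ((Finset.univ.filter (fun w => ∀ x ∈ G, w ∉ U x)).card : ℝ) := by
  rw [uncov_eq, ← cover_sum]
  have : (Fintype.card W : ℝ) = ∑ w : W, (1:ℝ) := by simp
  rw [this, ← Finset.sum_sub_distrib]
  refine Finset.sum_le_sum fun w _ => ?_
  by_cases h : (G.filter (fun x => w ∈ U x)).card = 0
  · rw [ind_true h, h]; simp
  · rw [ind_false h]
    have : (1:ℝ) ≤ ((G.filter (fun x => w ∈ U x)).card : ℝ) := by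
      exact_mod_cast Nat.one_le_iff_ne_zero.2 h
    linarith

lemma uncov_upper (G : Finset ι) (U : ι → Finset W)
    [DecidablePred fun w => ∀ x ∈ G, w ∉ U x] :
    ((Finset.univ.filter (fun w => ∀ x ∈ G, w ∉ U x)).card : ℝ) ≤
    (Fintype.card W : ℝ) - ∑ x ∈ G, ((U x).card : ℝ)
      + ∑ e ∈ G.offDiag, ((U e.1 ∩ U e.2).card : ℝ) := by
  rw [uncov_eq, ← cover_sum, ← cover_pairs]
  have : (Fintype.card W : ℝ) = ∑ w : W, (1:ℝ) := by simp
  rw [this, ← Finset.sum_sub_distrib, ← Finset.sum_add_distrib]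
  refine Finset.sum_le_sum fun w _ => ?_
  by_cases h : (G.filter (fun x => w ∈ U x)).card = 0
  · rw [ind_true h, h]; simp
  · rw [ind_false h]
    nlinarith [sq_nonneg (((G.filter (fun x => w ∈ U x)).card : ℝ) - 1)]

lemma uncov_upper' (G : Finset ι) (U : ι → Finset W)
    [DecidablePred fun w => ∀ x ∈ G, w ∉ U x] (d : ℕ)
    (hd : ∀ w, (G.filter (fun x => w ∈ U x)).card ≤ d) :
    d * ((Finset.univ.filter (fun w => ∀ x ∈ G, w ∉ U x)).card : ℝ) ≤
    d * (Fintype.card W : ℝ) - ∑ x ∈ G, ((U x).card : ℝ) := by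
  rw [uncov_eq, ← cover_sum]
  have : (Fintype.card W : ℝ) = ∑ w : W, (1:ℝ) := by simp
  rw [this, Finset.mul_sum, Finset.mul_sum, ← Finset.sum_sub_distrib]
  refine Finset.sum_le_sum fun w _ => ?_
  by_cases h : (G.filter (fun x => w ∈ U x)).card = 0
  · rw [ind_true h, h]; simp
  · rw [ind_false h]
    have : ((G.filter (fun x => w ∈ U x)).card : ℝ) ≤ d := by exact_mod_cast hd w
    linarith
end cover

lemma pow_upper (p : ℝ) (hp : 0 ≤ p) (hp1 : p ≤ 1) (g : ℕ) :
    (1 - p) ^ g ≤ 1 - g * p + (g * (g - 1)) * p ^ 2 := by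
  induction g with
  | zero => simp
  | succ g ih =>
    rw [pow_succ]
    have h0 : (0:ℝ) ≤ g * (g - 1) := by
      rcases Nat.eq_zero_or_pos g with rfl | h
      · simp
      · have : (1:ℝ) ≤ g := by exact_mod_cast h
        nlinarith
    have h1 := mul_le_mul_of_nonneg_right ih (sub_nonneg.2 hp1)
    refine h1.trans ?_
    have h2 : 0 ≤ (g * (g-1) : ℝ) * p ^ 3 := by positivity
    have h3 : 0 ≤ (g : ℝ) * p ^ 2 := by positivity
    push_cast
    nlinarith

lemma pow_lower (p : ℝ) (hp1 : p ≤ 1) (g : ℕ) : 1 - g * p ≤ (1 - p) ^ g := by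
  have := one_add_mul_le_pow (a := -p) (by linarith) g
  rw [← sub_eq_add_neg] at this
  linarith

lemma prod_diff {ι : Type*} (A : Finset ι) (a b c : ι → ℝ) (ha : ∀ i ∈ A, 0 ≤ a i)
    (hb : ∀ i ∈ A, 0 ≤ b i) (hac : ∀ i ∈ A, a i ≤ c i) (hbc : ∀ i ∈ A, b i ≤ c i) :
    |∏ i ∈ A, a i - ∏ i ∈ A, b i| ≤ ∑ i ∈ A, |a i - b i| * ∏ j ∈ A.erase i, c j := by
  induction A using Finset.induction_on with
  | empty => simp
  | insert i A hi ih =>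
    have ih' := ih (fun j hj => ha j (by simp [hj])) (fun j hj => hb j (by simp [hj]))
      (fun j hj => hac j (by simp [hj])) (fun j hj => hbc j (by simp [hj]))
    rw [Finset.prod_insert hi, Finset.prod_insert hi, Finset.sum_insert hi,
      Finset.erase_insert hi]
    have h1 : ∑ x ∈ A, |a x - b x| * ∏ j ∈ (insert i A).erase x, c j
        = c i * ∑ x ∈ A, |a x - b x| * ∏ j ∈ A.erase x, c j := by
      rw [Finset.mul_sum]
      refine Finset.sum_congr rfl fun x hx => ?_
      have hxi : i ≠ x := fun h => hi (h ▸ hx)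
      rw [Finset.erase_insert_of_ne hxi, Finset.prod_insert (by simp [hi])]
      ring
    rw [h1]
    have e : a i * ∏ i ∈ A, a i - b i * ∏ i ∈ A, b i
        = (a i - b i) * ∏ i ∈ A, a i + b i * (∏ i ∈ A, a i - ∏ i ∈ A, b i) := by ring
    rw [e]
    refine (abs_add_le _ _).trans (add_le_add ?_ ?_)
    · rw [abs_mul]
      refine mul_le_mul_of_nonneg_left ?_ (abs_nonneg _)
      rw [abs_of_nonneg (Finset.prod_nonneg fun j hj => ha j (by simp [hj]))]
      exact Finset.prod_le_prod (fun j hj => ha j (by simp [hj])) (fun j hj => hac j (by simp [hj]))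
    · rw [abs_mul, abs_of_nonneg (hb i (by simp))]
      exact mul_le_mul (hbc i (by simp)) ih' (abs_nonneg _)
        ((hb i (by simp)).trans (hbc i (by simp)))

/-! ### The groups -/

/-- keys of `S` in twisted group `α` -/
noncomputable def grp (S : Finset (Key s k)) (ω : Fin k → Bits s → Bits s × Bits r) (α : Bits s) :
    Finset (Key s k) := S.filter (fun x => (psi ω x).1 = α)

/-- fraction of shifts for which the group `α` has no value below `y`. -/
noncomputable def aa (S : Finset (Key s k)) (ω : Fin k → Bits s → Bits s × Bits r) (y : ℕ)
    (α : Bits s) : ℝ :=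
  ((Finset.univ.filter (fun w : Bits r => ∀ x ∈ grp S ω α,
    y ≤ bitsToNat ((psi ω x).2 + w))).card : ℝ) / 2 ^ r

/-- overlap -/
noncomputable def ov (y : ℕ) (δ : Bits r) : ℝ :=
  ((Finset.univ.filter (fun w : Bits r => bitsToNat w < y ∧ bitsToNat (δ + w) < y)).card : ℝ) / 2^r

noncomputable def qok (S : Finset (Key s k)) (q : Key s k)
    (ω : Fin k → Bits s → Bits s × Bits r) (z : Bits r) : Prop :=
  ∀ x ∈ grp S ω (psi ω q).1, bitsToNat z ≤ bitsToNat (z + ((psi ω x).2 - (psi ω q).2))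

noncomputable def QQ (S : Finset (Key s k)) (q : Key s k)
    (ω : Fin k → Bits s → Bits s × Bits r) (z : Bits r) : ℝ :=
  ind (qok S q ω z) * ∏ α ∈ Finset.univ.erase (psi ω q).1, aa S ω (bitsToNat z) α

/-- the cover set -/
noncomputable def US (ω : Fin k → Bits s → Bits s × Bits r) (y : ℕ) (x : Key s k) :
    Finset (Bits r) := Finset.univ.filter (fun w => bitsToNat ((psi ω x).2 + w) < y)

lemma US_card (ω : Fin k → Bits s → Bits s × Bits r) (y : ℕ) (hy : y ≤ 2^r) (x : Key s k) :
    (US ω y x).card = y := by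
  refine Eq.trans ?_ (card_val_lt y hy)
  unfold US
  refine Finset.card_bij' (fun w _ => (psi ω x).2 + w) (fun w _ => w - (psi ω x).2) ?_ ?_ ?_ ?_
  · intro a ha; simpa using ha
  · intro a ha; simpa using ha
  · intro a ha; simp
  · intro a ha; simp

lemma US_inter (ω : Fin k → Bits s → Bits s × Bits r) (y : ℕ) (x x' : Key s k) :
    ((US ω y x ∩ US ω y x').card : ℝ) / 2^r = ov y ((psi ω x').2 - (psi ω x).2) := by
  unfold ov US
  congr 2
  refine Finset.card_bij' (fun w _ => (psi ω x).2 + w) (fun w _ => w - (psi ω x).2) ?_ ?_ ?_ ?_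
  · intro a ha
    simp only [Finset.mem_inter, Finset.mem_filter, Finset.mem_univ, true_and] at ha ⊢
    refine ⟨ha.1, ?_⟩
    convert ha.2 using 2
    abel
  · intro a ha
    simp only [Finset.mem_inter, Finset.mem_filter, Finset.mem_univ, true_and] at ha ⊢
    constructor
    · convert ha.1 using 2; abel
    · convert ha.2 using 2; abel
  · intro a ha; simp
  · intro a ha; simp

lemma aa_eq (S : Finset (Key s k)) (ω : Fin k → Bits s → Bits s × Bits r) (y : ℕ) (α : Bits s) :
    aa S ω y α =
    ((Finset.univ.filter (fun w : Bits r => ∀ x ∈ grp S ω α, w ∉ US ω y x)).card : ℝ) / 2 ^ r := by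
  unfold aa US
  simp only [Finset.mem_filter, Finset.mem_univ, true_and, not_lt]

lemma aa_nonneg (S : Finset (Key s k)) (ω : Fin k → Bits s → Bits s × Bits r) (y : ℕ)
    (α : Bits s) : 0 ≤ aa S ω y α := by unfold aa; positivity

lemma aa_anti (S : Finset (Key s k)) (ω : Fin k → Bits s → Bits s × Bits r) {y y' : ℕ}
    (h : y ≤ y') (α : Bits s) : aa S ω y' α ≤ aa S ω y α := by
  unfold aa
  refine div_le_div_of_nonneg_right ?_ (by positivity)
  have : (Finset.univ.filter (fun w : Bits r => ∀ x ∈ grp S ω α,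
    y' ≤ bitsToNat ((psi ω x).2 + w))) ⊆ (Finset.univ.filter (fun w : Bits r => ∀ x ∈ grp S ω α,
    y ≤ bitsToNat ((psi ω x).2 + w))) := by
    intro w
    simp only [Finset.mem_filter, Finset.mem_univ, true_and]
    exact fun hw x hx => h.trans (hw x hx)
  exact_mod_cast Finset.card_le_card this

lemma aa_le_one (S : Finset (Key s k)) (ω : Fin k → Bits s → Bits s × Bits r) (y : ℕ)
    (α : Bits s) : aa S ω y α ≤ 1 := by
  unfold aa
  rw [div_le_one (by positivity)]
  have := Finset.card_le_univ (Finset.univ.filter (fun w : Bits r => ∀ x ∈ grp S ω α,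
    y ≤ bitsToNat ((psi ω x).2 + w)))
  rw [card_bits] at this
  exact_mod_cast this

lemma aa_diff (S : Finset (Key s k)) (ω : Fin k → Bits s → Bits s × Bits r) (y : ℕ)
    (hy : y ≤ 2^r) (α : Bits s) :
    |aa S ω y α - (1 - (y : ℝ) / 2^r) ^ (grp S ω α).card| ≤
      ∑ e ∈ (grp S ω α).offDiag, (ov y ((psi ω e.2).2 - (psi ω e.1).2) + ((y : ℝ) / 2^r)^2) := by
  have hm : (0:ℝ) < 2^r := by positivity
  have hyr : (y : ℝ) ≤ 2^r := by exact_mod_cast hy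
  set p : ℝ := (y : ℝ) / 2^r with hp
  have hp0 : 0 ≤ p := by positivity
  have hp1 : p ≤ 1 := by rw [hp, div_le_one hm]; exact hyr
  set X : ℝ := ((Finset.univ.filter
    (fun w : Bits r => ∀ x ∈ grp S ω α, w ∉ US ω y x)).card : ℝ) with hX
  have hl : _ ≤ X := uncov_lower (grp S ω α) (US ω y)
  have hu : X ≤ _ := uncov_upper (grp S ω α) (US ω y)
  have haa : aa S ω y α = X / 2^r := by rw [aa_eq]
  clear_value X
  simp only [US_card ω y hy, Finset.sum_const, nsmul_eq_mul, card_bits] at hl hu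
  push_cast at hl hu
  have h1 : 1 - (grp S ω α).card * p ≤ aa S ω y α := by
    rw [haa, le_div_iff₀ hm, hp]
    refine le_trans (le_of_eq ?_) hl
    field_simp
  have h2 : aa S ω y α ≤ 1 - (grp S ω α).card * p +
      ∑ e ∈ (grp S ω α).offDiag, ov y ((psi ω e.2).2 - (psi ω e.1).2) := by
    rw [haa, div_le_iff₀ hm]
    refine le_trans hu (le_of_eq ?_)
    simp_rw [← US_inter]
    rw [← Finset.sum_div, hp]
    field_simp
  have h3 := pow_lower p hp1 (grp S ω α).card
  have h4 := pow_upper p hp0 hp1 (grp S ω α).card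
  rw [Finset.sum_add_distrib, Finset.sum_const, Finset.offDiag_card, nsmul_eq_mul,
    Nat.cast_sub (Nat.le_mul_self _)]
  push_cast
  have h5 : 0 ≤ ∑ e ∈ (grp S ω α).offDiag, ov y ((psi ω e.2).2 - (psi ω e.1).2) :=
    Finset.sum_nonneg fun _ _ => by unfold ov; positivity
  have h6 : 0 ≤ ((grp S ω α).card * ((grp S ω α).card - 1) : ℝ) * p^2 := by
    linarith
  rw [abs_le]
  constructor <;> nlinarith

/-- differences that stay in the same group and the same dyadic interval -/
noncomputable def DD (s r b : ℕ) : Finset (Bits s × Bits r) :=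
  Finset.univ.filter (fun v => v.1 = 0 ∧ bitsToNat v.2 < 2^b)

lemma DD_card {b : ℕ} (hb : b ≤ r) : (DD s r b).card = 2^b := by
  have : DD s r b = ({0} : Finset (Bits s)) ×ˢ
      Finset.univ.filter (fun v : Bits r => bitsToNat v < 2^b) := by
    ext v; rw [Finset.mem_product]; simp [DD]
  rw [this, Finset.card_product, card_val_lt _ (Nat.pow_le_pow_right (by norm_num) hb)]
  simp

lemma aa_exp (S : Finset (Key s k)) (ω : Fin k → Bits s → Bits s × Bits r) (y b d : ℕ)
    (hd : 0 < d) (hb : b ≤ r) (hy : y ≤ 2^b)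
    (hgood : ∀ x ∈ S, (close S (DD s r b) x ω).card ≤ d) (α : Bits s) :
    aa S ω y α ≤ Real.exp (-((grp S ω α).card * ((y : ℝ) / 2^r) / d)) := by
  have hm : (0:ℝ) < 2^r := by positivity
  have hd' : (0:ℝ) < d := by exact_mod_cast hd
  have hyr : y ≤ 2^r := hy.trans (Nat.pow_le_pow_right (by norm_num) hb)
  set X : ℝ := ((Finset.univ.filter
    (fun w : Bits r => ∀ x ∈ grp S ω α, w ∉ US ω y x)).card : ℝ) with hX
  have haa : aa S ω y α = X / 2^r := by rw [aa_eq]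
  have h : d * X ≤ _ := uncov_upper' (grp S ω α) (US ω y) d (by
    intro w
    rcases Finset.eq_empty_or_nonempty ((grp S ω α).filter (fun x => w ∈ US ω y x)) with h | ⟨x, hx⟩
    · rw [h]; simp
    · have hxS : x ∈ S := (Finset.mem_filter.1 (Finset.mem_filter.1 hx).1).1
      refine le_trans (Finset.card_le_card ?_) (hgood x hxS)
      intro x' hx'
      simp only [grp, US, Finset.mem_filter, Finset.mem_univ, true_and] at hx hx'
      simp only [close, DD, Finset.mem_filter, Finset.mem_univ, true_and, Prod.fst_sub,
        Prod.snd_sub]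
      refine ⟨hx'.1.1, by rw [hx.1.2, hx'.1.2, sub_self], ?_⟩
      have := val_sub_lt (lt_of_lt_of_le hx'.2 hy) (lt_of_lt_of_le hx.2 hy)
      convert this using 2
      abel)
  simp only [US_card ω y hyr, Finset.sum_const, nsmul_eq_mul, card_bits] at h
  push_cast at h
  have h1 : aa S ω y α ≤ 1 - ((grp S ω α).card * ((y : ℝ) / 2^r) / d) := by
    rw [haa, div_le_iff₀ hm]
    rw [mul_comm, ← le_div_iff₀ hd'] at h
    refine h.trans (le_of_eq ?_)
    field_simp
  refine h1.trans ?_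
  have := Real.add_one_le_exp (-((grp S ω α).card * ((y : ℝ) / 2^r) / d))
  linarith

lemma sum_grp_card (S : Finset (Key s k)) (ω : Fin k → Bits s → Bits s × Bits r) :
    ∑ α, (grp S ω α).card = S.card :=
  (Finset.card_eq_sum_card_fiberwise (f := fun x => (psi ω x).1) (t := Finset.univ)
    (by intro x _; simp)).symm

lemma pr_eq (S : Finset (Key s k)) (q : Key s k) :
    Pr (fun ω : (Fin k → Bits s → Bits s × Bits r) × (Bits s → Bits r) =>
              ∀ x ∈ S, bitsToNat (twistedTab ω q) ≤ bitsToNat (twistedTab ω x))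
      = av (fun z : Bits r => av (fun ω => QQ S q ω z)) := by
  have hω : ∀ ω : Fin k → Bits s → Bits s × Bits r,
      ((Finset.univ.filter (fun h0 : Bits s → Bits r => ∀ x ∈ S,
        bitsToNat (twistedTab (ω, h0) q) ≤ bitsToNat (twistedTab (ω, h0) x))).card : ℝ)
      = (∑ z, QQ S q ω z) * (2^r) ^ (2^s - 1) := by
    intro ω
    rw [Finset.card_eq_sum_card_fiberwise (f := fun h0 => (psi ω q).2 + h0 (psi ω q).1)
      (t := Finset.univ) (by intro x _; simp), Nat.cast_sum, Finset.sum_mul]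
    refine Finset.sum_congr rfl fun z _ => ?_
    have e1 : ((Finset.univ.filter (fun h0 : Bits s → Bits r => ∀ x ∈ S,
        bitsToNat (twistedTab (ω, h0) q) ≤ bitsToNat (twistedTab (ω, h0) x))).filter
        (fun h0 => (psi ω q).2 + h0 (psi ω q).1 = z)) =
        Fintype.piFinset (fun α => if α = (psi ω q).1 then
          (if qok S q ω z then {z - (psi ω q).2} else ∅) else
          Finset.univ.filter (fun w : Bits r => ∀ x ∈ grp S ω α,
            bitsToNat z ≤ bitsToNat ((psi ω x).2 + w))) := by
      ext h0
      simp only [Finset.mem_filter, Finset.mem_univ, true_and, Fintype.mem_piFinset,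
        twistedTab_eq]
      constructor
      · rintro ⟨h1, h2⟩ α
        rw [h2] at h1
        split_ifs with h3 h4
        · subst h3; rw [Finset.mem_singleton, ← h2]; simp
        · exfalso; apply h4
          intro x hx
          obtain ⟨hxS, hxg⟩ := Finset.mem_filter.1 hx
          have := h1 x hxS
          convert this using 2
          rw [hxg, ← h2]; abel
        · rw [Finset.mem_filter]
          refine ⟨Finset.mem_univ _, fun x hx => ?_⟩
          obtain ⟨hxS, hxg⟩ := Finset.mem_filter.1 hx
          have := h1 x hxS
          rwa [hxg] at this
      · intro h
        have hq := h (psi ω q).1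
        rw [if_pos rfl] at hq
        by_cases h4 : qok S q ω z
        · rw [if_pos h4, Finset.mem_singleton] at hq
          have h2 : (psi ω q).2 + h0 (psi ω q).1 = z := by rw [hq]; abel
          refine ⟨fun x hx => ?_, h2⟩
          rw [h2]
          by_cases hxq : (psi ω x).1 = (psi ω q).1
          · have := h4 x (Finset.mem_filter.2 ⟨hx, hxq⟩)
            convert this using 2
            rw [hxq, hq]; abel
          · have := h (psi ω x).1
            rw [if_neg hxq, Finset.mem_filter] at this
            exact this.2 x (Finset.mem_filter.2 ⟨hx, rfl⟩)
        · rw [if_neg h4] at hq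
          simp at hq
    rw [e1, Fintype.card_piFinset,
      ← Finset.mul_prod_erase Finset.univ _ (Finset.mem_univ (psi ω q).1), if_pos rfl]
    unfold QQ
    push_cast
    have e2 : ∏ α ∈ Finset.univ.erase (psi ω q).1, aa S ω (bitsToNat z) α * (2:ℝ)^r
        = ∏ α ∈ Finset.univ.erase (psi ω q).1, (((if α = (psi ω q).1 then
          (if qok S q ω z then {z - (psi ω q).2} else ∅) else
          Finset.univ.filter (fun w : Bits r => ∀ x ∈ grp S ω α,
            bitsToNat z ≤ bitsToNat ((psi ω x).2 + w))).card : ℕ) : ℝ) := by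
      refine Finset.prod_congr rfl fun α hα => ?_
      rw [if_neg (Finset.ne_of_mem_erase hα)]
      unfold aa
      rw [div_mul_cancel₀ _ (by positivity)]
    rw [← e2, Finset.prod_mul_distrib, Finset.prod_const, Finset.card_erase_of_mem (Finset.mem_univ _),
      Finset.card_univ, card_bits, ← mul_assoc]
    congr 2
    by_cases h4 : qok S q ω z
    · rw [ind_true h4, if_pos h4]; simp
    · rw [ind_false h4, if_neg h4]; simp
  unfold Pr
  rw [← sum_ind_card, Fintype.sum_prod_type]
  have hcard : ∀ ω : Fin k → Bits s → Bits s × Bits r,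
      ∑ h0 : Bits s → Bits r, ind (∀ x ∈ S,
        bitsToNat (twistedTab (ω, h0) q) ≤ bitsToNat (twistedTab (ω, h0) x))
      = (∑ z, QQ S q ω z) * (2^r) ^ (2^s - 1) := by
    intro ω
    rw [sum_ind_card]
    exact hω ω
  rw [Finset.sum_congr rfl (fun ω _ => hcard ω), ← Finset.sum_mul, Finset.sum_comm]
  have hc : (Fintype.card ((Fin k → Bits s → Bits s × Bits r) × (Bits s → Bits r)) : ℝ)
      = Fintype.card (Fin k → Bits s → Bits s × Bits r) * (2^r * (2^r)^(2^s-1)) := by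
    rw [Fintype.card_prod, Fintype.card_fun (α := Bits s) (β := Bits r), card_bits, card_bits]
    have : 2^s = 2^s - 1 + 1 := (Nat.sub_add_cancel Nat.one_le_two_pow).symm
    push_cast
    congr 1
    conv_lhs => rw [this, pow_succ]
    ring
  rw [hc]
  unfold av
  rw [card_bits, ← Finset.sum_div]
  push_cast
  have : (Fintype.card (Fin k → Bits s → Bits s × Bits r) : ℝ) ≠ 0 := by positivity
  field_simp

/-! ### Good tables -/

def good (S : Finset (Key s k)) (b d : ℕ) (ω : Fin k → Bits s → Bits s × Bits r) : Prop :=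
  (∀ x ∈ S, (close S (DD s r b) x ω).card ≤ d) ∧
    (8 * d ≤ S.card → ∀ α, 4 * (grp S ω α).card ≤ S.card)

lemma ind_mono {P Q : Prop} (h : P → Q) : ind P ≤ ind Q := by
  by_cases hP : P
  · rw [ind_true hP, ind_true (h hP)]
  · rw [ind_false hP]; exact ind_nonneg _

lemma DD_fst {b : ℕ} : ∀ v ∈ DD s r b, v.1 = 0 := by
  intro v hv; exact (Finset.mem_filter.1 hv).2.1

lemma card_V : (Fintype.card (Bits s × Bits r) : ℝ) = 2^s * 2^r := by
  rw [Fintype.card_prod, card_bits, card_bits]; push_cast; rfl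

lemma grp_eq_close (S : Finset (Key s k)) (ω : Fin k → Bits s → Bits s × Bits r) (x : Key s k) :
    grp S ω (psi ω x).1 = close S (DD s r r) x ω := by
  ext x'
  simp [grp, close, DD, val_lt, sub_eq_zero]

lemma bad_prob (S : Finset (Key s k)) (l b : ℕ) (hb : b ≤ r) (hS : 0 < S.card) :
    av (fun ω : Fin k → Bits s → Bits s × Bits r => ind (¬ good S b ((l+1)^k) ω)) ≤
      S.card * (S.card * 2^b / (2^s * 2^r))^l + S.card * (8 / 2^s)^l := by
  set d := (l+1)^k with hd
  have hn : (0:ℝ) < S.card := by exact_mod_cast hS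
  have h1 : ∀ ω : Fin k → Bits s → Bits s × Bits r, ind (¬ good S b d ω) ≤
      ∑ x ∈ S, ind (d < (close S (DD s r b) x ω).card) +
      ∑ x ∈ S, ind (8 * d ≤ S.card ∧ S.card / 4 < (close S (DD s r r) x ω).card) := by
    intro ω
    have hp1 : 0 ≤ ∑ x ∈ S, ind (d < (close S (DD s r b) x ω).card) :=
      Finset.sum_nonneg fun _ _ => ind_nonneg _
    have hp2 : 0 ≤ ∑ x ∈ S, ind (8 * d ≤ S.card ∧ S.card / 4 < (close S (DD s r r) x ω).card) :=
      Finset.sum_nonneg fun _ _ => ind_nonneg _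
    by_cases hg : good S b d ω
    · rw [ind_false (not_not.2 hg)]; linarith
    · rw [ind_true hg]
      unfold good at hg
      rw [not_and_or] at hg
      rcases hg with hg | hg
      · push Not at hg
        obtain ⟨x, hx, hlt⟩ := hg
        have := Finset.single_le_sum (f := fun x => ind (d < (close S (DD s r b) x ω).card))
          (fun _ _ => ind_nonneg _) hx
        simp only [ind_true hlt] at this
        linarith
      · push Not at hg
        obtain ⟨h8, α, hα⟩ := hg
        have hne : (grp S ω α).Nonempty := by
          rw [← Finset.card_pos]; omega
        obtain ⟨x, hx⟩ := hne
        obtain ⟨hxS, hxα⟩ := Finset.mem_filter.1 hx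
        rw [← hxα, grp_eq_close] at hα
        have hc : 8 * d ≤ S.card ∧ S.card / 4 < (close S (DD s r r) x ω).card := ⟨h8, by omega⟩
        have := Finset.single_le_sum
          (f := fun x => ind (8 * d ≤ S.card ∧ S.card / 4 < (close S (DD s r r) x ω).card))
          (fun _ _ => ind_nonneg _) hxS
        simp only [ind_true hc] at this
        linarith
  refine (av_mono h1).trans ?_
  rw [av_add, av_sum, av_sum]
  refine add_le_add ?_ ?_
  · rw [← nsmul_eq_mul]
    refine Finset.sum_le_card_nsmul _ _ _ fun x hx => ?_
    have := moment S (DD s r b) DD_fst x l d 1 (by norm_num) (by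
      intro a ha
      have : 1 ≤ a - (l+1)^k := by omega
      exact_mod_cast this)
    rw [one_pow, one_mul, DD_card hb, card_V] at this
    push_cast at this
    rwa [← mul_div_assoc] at this
  · rw [← nsmul_eq_mul]
    refine Finset.sum_le_card_nsmul _ _ _ fun x hx => ?_
    by_cases h8 : 8 * d ≤ S.card
    · simp only [h8, true_and]
      have := moment S (DD s r r) DD_fst x l (S.card / 4) (S.card / 8) (by positivity) (by
        intro a ha
        have : S.card ≤ 8 * (a - (l+1)^k) := by omega
        have h' : (S.card : ℝ) ≤ 8 * ((a - (l+1)^k : ℕ) : ℝ) := by exact_mod_cast this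
        linarith)
      rw [DD_card le_rfl, card_V, mul_comm, ← le_div_iff₀ (by positivity), ← div_pow] at this
      refine this.trans (le_of_eq ?_)
      congr 1
      push_cast
      field_simp
    · simp only [h8, false_and]
      rw [ind_false not_false, av_const]
      positivity

/-! ### Expectations of pair functions -/

lemma av_pair_le (x x' : Key s k) (hne : x ≠ x') (f : Bits s × Bits r → ℝ) (h0 : ∀ v, 0 ≤ f v)
    (hf : ∀ v, v.1 ≠ 0 → f v = 0) : av (fun ω => f (psi ω x - psi ω x')) ≤ av f := by
  by_cases h : x.2 = x'.2
  · have h1 : x.1 ≠ x'.1 := fun h1 => hne (Prod.ext h1 h)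
    have : (fun ω => f (psi ω x - psi ω x')) = fun _ => 0 := by
      funext ω
      apply hf
      simp [psi, h, sub_eq_zero, h1]
    rw [this, av_const]
    exact av_nonneg h0
  · rw [av_pair x x' h]

lemma av_fst (g : Bits r → ℝ) :
    av (fun v : Bits s × Bits r => ind (v.1 = 0) * g v.2) = av g / 2^s := by
  unfold av
  rw [Fintype.sum_prod_type, card_V, card_bits]
  have : ∑ a : Bits s, ∑ b : Bits r, ind (a = 0) * g b = ∑ b, g b := by
    rw [Finset.sum_eq_single (0 : Bits s)]
    · simp [ind_true]
    · intro a _ ha; simp [ind_false ha]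
    · simp
  rw [this]
  push_cast
  field_simp

lemma av_ind_lt (y : ℕ) (hy : y ≤ 2^r) (z : Bits r) :
    av (fun v : Bits r => ind (bitsToNat (z + v) < y)) = y / 2^r := by
  have h := Equiv.sum_comp (Equiv.addLeft z) (fun v => ind (bitsToNat v < y))
  simp only [Equiv.coe_addLeft] at h
  unfold av
  rw [h, sum_ind_card, card_val_lt y hy, card_bits]
  push_cast; rfl

lemma av_ov (y : ℕ) (hy : y ≤ 2^r) : av (ov (r := r) y) = (y / 2^r)^2 := by
  have h : ∀ δ : Bits r, ov y δ = (∑ w : Bits r, ind (bitsToNat w < y) *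
      ind (bitsToNat (w + δ) < y)) / 2^r := by
    intro δ
    unfold ov
    rw [← sum_ind_card]
    congr 1
    refine Finset.sum_congr rfl fun w _ => ?_
    rw [ind_and, mul_comm, add_comm]
  have h2 : av (ov (r := r) y) = (∑ w : Bits r, ind (bitsToNat w < y) *
      av (fun δ => ind (bitsToNat (w + δ) < y))) / 2^r := by
    unfold av
    simp_rw [h]
    rw [← Finset.sum_div, Finset.sum_comm]
    simp_rw [← Finset.mul_sum, ← mul_div_assoc]
    rw [← Finset.sum_div]
    ring
  rw [h2]
  simp_rw [av_ind_lt y hy]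
  rw [← Finset.sum_mul, sum_ind_card, card_val_lt y hy]
  ring

noncomputable def phi1 (s : ℕ) (z : Bits r) (v : Bits s × Bits r) : ℝ :=
  ind (v.1 = 0) * (ind (bitsToNat (z + v.2) < bitsToNat z) + (bitsToNat z : ℝ) / 2^r)

noncomputable def phi2 (s : ℕ) (z : Bits r) (v : Bits s × Bits r) : ℝ :=
  ind (v.1 = 0) * (ov (bitsToNat z) v.2 + ((bitsToNat z : ℝ) / 2^r)^2)

lemma ov_nonneg (y : ℕ) (δ : Bits r) : 0 ≤ ov y δ := by unfold ov; positivity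

lemma phi1_nonneg (z : Bits r) (v : Bits s × Bits r) : 0 ≤ phi1 s z v :=
  mul_nonneg (ind_nonneg _) (add_nonneg (ind_nonneg _) (by positivity))

lemma phi2_nonneg (z : Bits r) (v : Bits s × Bits r) : 0 ≤ phi2 s z v :=
  mul_nonneg (ind_nonneg _) (add_nonneg (ov_nonneg _ _) (by positivity))

lemma av_phi1 (z : Bits r) : av (phi1 s z) = 2 * ((bitsToNat z : ℝ) / 2^r) / 2^s := by
  unfold phi1
  rw [av_fst (fun v => ind (bitsToNat (z + v) < bitsToNat z) + (bitsToNat z : ℝ) / 2^r), av_add,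
    av_const, av_ind_lt _ (val_lt z).le]
  ring

lemma av_phi2 (z : Bits r) : av (phi2 s z) = 2 * ((bitsToNat z : ℝ) / 2^r)^2 / 2^s := by
  unfold phi2
  rw [av_fst (fun v => ov (bitsToNat z) v + ((bitsToNat z : ℝ) / 2^r)^2), av_add,
    av_const, av_ov _ (val_lt z).le]
  ring

/-! ### Pointwise comparison -/

lemma QQ_nonneg (S : Finset (Key s k)) (q : Key s k)
    (ω : Fin k → Bits s → Bits s × Bits r) (z : Bits r) : 0 ≤ QQ S q ω z :=
  mul_nonneg (ind_nonneg _) (Finset.prod_nonneg fun _ _ => aa_nonneg _ _ _ _)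

lemma QQ_le_one (S : Finset (Key s k)) (q : Key s k)
    (ω : Fin k → Bits s → Bits s × Bits r) (z : Bits r) : QQ S q ω z ≤ 1 :=
  mul_le_one₀ (ind_le_one _) (Finset.prod_nonneg fun _ _ => aa_nonneg _ _ _ _)
    (Finset.prod_le_one (fun _ _ => aa_nonneg _ _ _ _) (fun _ _ => aa_le_one _ _ _ _))

lemma p_bounds (z : Bits r) : 0 ≤ (bitsToNat z : ℝ) / 2^r ∧ (bitsToNat z : ℝ) / 2^r ≤ 1 := by
  refine ⟨by positivity, ?_⟩
  rw [div_le_one (by positivity)]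
  exact_mod_cast (val_lt z).le

/-- the damping factor -/
noncomputable def WW (n d : ℕ) (p : ℝ) : ℝ := if 8 * d ≤ n then Real.exp (-(n * p / (2 * d))) else 1

lemma WW_nonneg (n d : ℕ) (p : ℝ) : 0 ≤ WW n d p := by
  unfold WW; split_ifs <;> positivity

lemma WW_bound (n d : ℕ) (hd : 0 < d) (p : ℝ) (hp : 0 ≤ p) (hp1 : p ≤ 1) :
    (n * p)^2 * WW n d p ≤ 64 * d^2 := by
  have hd' : (0:ℝ) < d := by exact_mod_cast hd
  unfold WW
  split_ifs with h
  · set x : ℝ := n * p / (2 * d) with hx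
    have hx0 : 0 ≤ x := by positivity
    have e : (n * p : ℝ) = 2 * d * x := by rw [hx]; field_simp
    rw [e]
    have h1 := Real.quadratic_le_exp_of_nonneg hx0
    have h2 : x^2 * Real.exp (-x) ≤ 2 := by
      rw [Real.exp_neg, ← div_eq_mul_inv, div_le_iff₀ (Real.exp_pos _)]
      nlinarith
    nlinarith [sq_nonneg (d : ℝ)]
  · have h1 : (n : ℝ) ≤ 8 * d := by exact_mod_cast (not_le.1 h).le
    have h2 : n * p ≤ 8 * d := by nlinarith [(Nat.cast_nonneg n : (0:ℝ) ≤ n)]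
    have h3 : 0 ≤ n * p := by positivity
    nlinarith

lemma sum_insert_le {ι : Type*} [DecidableEq ι] (f : ι → ℕ) (a : ι) (A : Finset ι) :
    ∑ γ ∈ insert a A, f γ ≤ f a + ∑ γ ∈ A, f γ := by
  by_cases h : a ∈ A
  · rw [Finset.insert_eq_of_mem h]; omega
  · rw [Finset.sum_insert h]

lemma good_prod (S : Finset (Key s k)) (ω : Fin k → Bits s → Bits s × Bits r) (b d : ℕ)
    (hg : good S b d ω) (p : ℝ) (hp : 0 ≤ p) (hd : 0 < d) (A : Finset (Bits s)) (α β : Bits s)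
    (hA : ∀ γ, γ ≠ α → γ ≠ β → γ ∈ A) :
    ∏ γ ∈ A, Real.exp (-((grp S ω γ).card * p / d)) ≤ WW S.card d p := by
  have hd' : (0:ℝ) < d := by exact_mod_cast hd
  unfold WW
  split_ifs with h
  · rw [← Real.exp_sum, Real.exp_le_exp, Finset.sum_neg_distrib, neg_le_neg_iff, ← Finset.sum_div,
      ← Finset.sum_mul]
    have h1 : (S.card : ℝ) ≤ ∑ γ ∈ A, ((grp S ω γ).card : ℝ) + (grp S ω α).card
        + (grp S ω β).card := by
      have : S.card ≤ ∑ γ ∈ A, (grp S ω γ).card + (grp S ω α).card + (grp S ω β).card := by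
        rw [← sum_grp_card S ω]
        calc ∑ γ, (grp S ω γ).card ≤ ∑ γ ∈ insert α (insert β A), (grp S ω γ).card := by
              refine Finset.sum_le_sum_of_subset ?_
              intro γ _
              simp only [Finset.mem_insert]
              by_cases h1 : γ = α
              · exact Or.inl h1
              · by_cases h2 : γ = β
                · exact Or.inr (Or.inl h2)
                · exact Or.inr (Or.inr (hA γ h1 h2))
          _ ≤ (grp S ω α).card + ((grp S ω β).card + ∑ γ ∈ A, (grp S ω γ).card) := by
              refine (sum_insert_le _ _ _).trans (Nat.add_le_add_left
                (sum_insert_le _ _ _) _)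
          _ = _ := by ring
      exact_mod_cast this
    have h2 : (4 * (grp S ω α).card : ℝ) ≤ S.card := by exact_mod_cast hg.2 h α
    have h3 : (4 * (grp S ω β).card : ℝ) ≤ S.card := by exact_mod_cast hg.2 h β
    rw [div_le_div_iff₀ (by positivity) hd']
    have h4 : (S.card : ℝ) ≤ 2 * ∑ γ ∈ A, ((grp S ω γ).card : ℝ) := by linarith
    have h5 := mul_le_mul_of_nonneg_right h4 (mul_nonneg hp hd'.le)
    nlinarith
  · refine Finset.prod_le_one (fun _ _ => (Real.exp_pos _).le) fun γ _ => ?_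
    rw [Real.exp_le_one_iff, neg_nonpos]
    positivity

lemma pairs_sum (S : Finset (Key s k)) (ω : Fin k → Bits s → Bits s × Bits r) (A : Finset (Bits s))
    (z : Bits r) :
    ∑ α ∈ A, ∑ e ∈ (grp S ω α).offDiag, (ov (bitsToNat z) ((psi ω e.2).2 - (psi ω e.1).2)
        + ((bitsToNat z : ℝ) / 2^r)^2)
      ≤ ∑ e ∈ S.offDiag, phi2 s z (psi ω e.2 - psi ω e.1) := by
  refine (Finset.sum_le_sum_of_subset_of_nonneg (Finset.subset_univ A) (fun α _ _ =>
    Finset.sum_nonneg fun e _ => add_nonneg (ov_nonneg _ _) (by positivity))).trans ?_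
  have h : ∀ α, ∑ e ∈ (grp S ω α).offDiag, (ov (bitsToNat z) ((psi ω e.2).2 - (psi ω e.1).2)
        + ((bitsToNat z : ℝ) / 2^r)^2)
      = ∑ e ∈ S.offDiag, ind ((psi ω e.1).1 = α) * phi2 s z (psi ω e.2 - psi ω e.1) := by
    intro α
    have e1 : (grp S ω α).offDiag = S.offDiag.filter
        (fun e => (psi ω e.1).1 = α ∧ (psi ω e.2).1 = α) := by
      ext e; simp only [grp, Finset.mem_filter, Finset.mem_offDiag]; tauto
    rw [e1, Finset.sum_filter]
    refine Finset.sum_congr rfl fun e _ => ?_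
    unfold phi2
    rw [Prod.fst_sub, Prod.snd_sub, sub_eq_zero]
    by_cases h1 : (psi ω e.1).1 = α
    · by_cases h2 : (psi ω e.2).1 = α
      · rw [if_pos ⟨h1, h2⟩, ind_true h1, ind_true (h2.trans h1.symm)]; ring
      · rw [if_neg (fun h => h2 h.2), ind_false (P := (psi ω e.2).1 = (psi ω e.1).1) (fun h => h2 (h.trans h1))]; ring
    · rw [if_neg (fun h => h1 h.1), ind_false h1]; ring
  rw [Finset.sum_congr rfl (fun α _ => h α), Finset.sum_comm]
  refine Finset.sum_le_sum fun e _ => ?_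
  rw [← Finset.sum_mul, Finset.sum_eq_single (psi ω e.1).1, ind_true rfl, one_mul]
  · intro α _ hα; exact ind_false (Ne.symm hα)
  · simp

lemma q_part (S : Finset (Key s k)) (q : Key s k) (hq : q ∈ S)
    (ω : Fin k → Bits s → Bits s × Bits r) (z : Bits r) :
    |ind (qok S q ω z) - (1 - (bitsToNat z : ℝ) / 2^r) ^ ((grp S ω (psi ω q).1).card - 1)|
      ≤ ∑ x ∈ S.erase q, phi1 s z (psi ω x - psi ω q) := by
  obtain ⟨hp0, hp1⟩ := p_bounds z
  set p : ℝ := (bitsToNat z : ℝ) / 2^r with hp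
  set g := (grp S ω (psi ω q).1).card - 1 with hgdef
  have hl := pow_lower p hp1 g
  have hu : (1 - p)^g ≤ 1 := pow_le_one₀ (by linarith) (by linarith)
  have h0 : 0 ≤ (1 - p)^g := pow_nonneg (by linarith) _
  have hsum : ∑ x ∈ S.erase q, phi1 s z (psi ω x - psi ω q)
      = ∑ x ∈ S.erase q, ind ((psi ω x - psi ω q).1 = 0) *
        ind (bitsToNat (z + (psi ω x - psi ω q).2) < bitsToNat z) + g * p := by
    unfold phi1
    simp only [mul_add, Finset.sum_add_distrib]
    congr 1
    rw [← Finset.sum_mul]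
    congr 1
    rw [sum_ind_card, hgdef]
    have hqm : q ∈ grp S ω (psi ω q).1 := Finset.mem_filter.2 ⟨hq, rfl⟩
    rw [← Finset.card_erase_of_mem hqm]
    congr 2
    ext x
    simp only [grp, Finset.mem_filter, Finset.mem_erase, Prod.fst_sub, sub_eq_zero]
    tauto
  have hnn : 0 ≤ ∑ x ∈ S.erase q, ind ((psi ω x - psi ω q).1 = 0) *
        ind (bitsToNat (z + (psi ω x - psi ω q).2) < bitsToNat z) :=
    Finset.sum_nonneg fun _ _ => mul_nonneg (ind_nonneg _) (ind_nonneg _)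
  have hgp : 0 ≤ g * p := by positivity
  rw [hsum]
  by_cases hk : qok S q ω z
  · rw [ind_true hk, abs_le]
    constructor <;> linarith
  · rw [ind_false hk]
    have h1 : 1 ≤ ∑ x ∈ S.erase q, ind ((psi ω x - psi ω q).1 = 0) *
        ind (bitsToNat (z + (psi ω x - psi ω q).2) < bitsToNat z) := by
      unfold qok at hk
      push Not at hk
      obtain ⟨x, hx, hlt⟩ := hk
      obtain ⟨hxS, hxg⟩ := Finset.mem_filter.1 hx
      have hxq : x ≠ q := by
        rintro rfl; simp at hlt
      have := Finset.single_le_sum (f := fun x => ind ((psi ω x - psi ω q).1 = 0) *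
        ind (bitsToNat (z + (psi ω x - psi ω q).2) < bitsToNat z))
        (fun _ _ => mul_nonneg (ind_nonneg _) (ind_nonneg _)) (Finset.mem_erase.2 ⟨hxq, hxS⟩)
      have hlt2 : bitsToNat (z + (psi ω x - psi ω q).2) < bitsToNat z := hlt
      rw [ind_true (by rw [Prod.fst_sub, hxg, sub_self]), ind_true hlt2] at this
      linarith
    rw [abs_le]
    constructor <;> linarith

lemma point_good (S : Finset (Key s k)) (q : Key s k) (hq : q ∈ S) (b d : ℕ) (hd : 0 < d)
    (hb : b ≤ r) (ω : Fin k → Bits s → Bits s × Bits r) (hg : good S b d ω) (z : Bits r)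
    (hz : bitsToNat z ≤ 2^b) :
    |QQ S q ω z - (1 - (bitsToNat z : ℝ) / 2^r) ^ (S.card - 1)| ≤
      ∑ x ∈ S.erase q, phi1 s z (psi ω x - psi ω q) +
      WW S.card d ((bitsToNat z : ℝ) / 2^r) *
        ∑ e ∈ S.offDiag, phi2 s z (psi ω e.2 - psi ω e.1) := by
  obtain ⟨hp0, hp1⟩ := p_bounds z
  have hd' : (0:ℝ) < d := by exact_mod_cast hd
  have hd1 : (1:ℝ) ≤ d := by exact_mod_cast hd
  set p : ℝ := (bitsToNat z : ℝ) / 2^r with hp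
  set αq := (psi ω q).1 with hαq
  have hqm : q ∈ grp S ω αq := Finset.mem_filter.2 ⟨hq, rfl⟩
  have hcard : S.card - 1 = (grp S ω αq).card - 1 + ∑ α ∈ Finset.univ.erase αq, (grp S ω α).card := by
    have h1 := Finset.add_sum_erase Finset.univ (fun α => (grp S ω α).card) (Finset.mem_univ αq)
    rw [sum_grp_card] at h1
    have h2 : 0 < (grp S ω αq).card := Finset.card_pos.2 ⟨q, hqm⟩
    omega
  rw [hcard, pow_add, ← Finset.prod_pow_eq_pow_sum]
  unfold QQ
  set X := ind (qok S q ω z)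
  set Y := (1 - p) ^ ((grp S ω αq).card - 1) with hY
  set Pa := ∏ α ∈ Finset.univ.erase αq, aa S ω (bitsToNat z) α with hPa
  set Pb := ∏ α ∈ Finset.univ.erase αq, (1 - p) ^ (grp S ω α).card with hPb
  have hPa0 : 0 ≤ Pa := Finset.prod_nonneg fun _ _ => aa_nonneg _ _ _ _
  have hPa1 : Pa ≤ 1 :=
    Finset.prod_le_one (fun _ _ => aa_nonneg _ _ _ _) (fun _ _ => aa_le_one _ _ _ _)
  have hY0 : 0 ≤ Y := pow_nonneg (by linarith) _
  have hY1 : Y ≤ 1 := pow_le_one₀ (by linarith) (by linarith)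
  have h1 : |X - Y| ≤ ∑ x ∈ S.erase q, phi1 s z (psi ω x - psi ω q) := q_part S q hq ω z
  have h2 : |Pa - Pb| ≤ WW S.card d p * ∑ e ∈ S.offDiag, phi2 s z (psi ω e.2 - psi ω e.1) := by
    have := prod_diff (Finset.univ.erase αq) (fun α => aa S ω (bitsToNat z) α)
      (fun α => (1 - p) ^ (grp S ω α).card)
      (fun α => Real.exp (-((grp S ω α).card * p / d)))
      (fun _ _ => aa_nonneg _ _ _ _) (fun _ _ => pow_nonneg (by linarith) _)
      (fun α _ => aa_exp S ω (bitsToNat z) b d hd hb hz hg.1 α)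
      (by
        intro α _
        have e1 : (1 - p) ≤ Real.exp (-p) := by
          have := Real.add_one_le_exp (-p); linarith
        calc (1 - p) ^ (grp S ω α).card ≤ (Real.exp (-p)) ^ (grp S ω α).card :=
              pow_le_pow_left₀ (by linarith) e1 _
          _ = Real.exp (-((grp S ω α).card * p)) := by
              rw [← Real.exp_nat_mul]; congr 1; ring
          _ ≤ _ := by
              rw [Real.exp_le_exp, neg_le_neg_iff, div_le_iff₀ hd']
              have : 0 ≤ (grp S ω α).card * p := by positivity
              nlinarith)
    refine this.trans ?_
    calc _ ≤ ∑ α ∈ Finset.univ.erase αq, (∑ e ∈ (grp S ω α).offDiag,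
          (ov (bitsToNat z) ((psi ω e.2).2 - (psi ω e.1).2) + p^2)) * WW S.card d p := by
            refine Finset.sum_le_sum fun α _ => ?_
            refine mul_le_mul (aa_diff S ω _ (val_lt z).le α) ?_
              (Finset.prod_nonneg fun _ _ => (Real.exp_pos _).le)
              (Finset.sum_nonneg fun e _ => add_nonneg (ov_nonneg _ _) (by positivity))
            refine good_prod S ω b d hg p hp0 hd _ α αq ?_
            intro γ h1 h2
            simp [h1, h2]
      _ = WW S.card d p * ∑ α ∈ Finset.univ.erase αq, (∑ e ∈ (grp S ω α).offDiag,
          (ov (bitsToNat z) ((psi ω e.2).2 - (psi ω e.1).2) + p^2)) := by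
            rw [← Finset.sum_mul, mul_comm]
      _ ≤ _ := mul_le_mul_of_nonneg_left (pairs_sum S ω _ z) (WW_nonneg _ _ _)
  have e : X * Pa - Y * Pb = (X - Y) * Pa + Y * (Pa - Pb) := by ring
  rw [e]
  refine (abs_add_le _ _).trans (add_le_add ?_ ?_)
  · rw [abs_mul, abs_of_nonneg hPa0]
    exact (mul_le_of_le_one_right (abs_nonneg _) hPa1).trans h1
  · rw [abs_mul, abs_of_nonneg hY0]
    exact (mul_le_of_le_one_left (abs_nonneg _) hY1).trans h2

lemma main_part (S : Finset (Key s k)) (q : Key s k) (hq : q ∈ S) (b d : ℕ) (hd : 0 < d)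
    (hb : b ≤ r) (z : Bits r) (hz : bitsToNat z ≤ 2^b) :
    |av (fun ω => QQ S q ω z) - (1 - (bitsToNat z : ℝ) / 2^r) ^ (S.card - 1)| ≤
      av (fun ω : Fin k → Bits s → Bits s × Bits r => ind (¬ good S b d ω)) +
      2 * (S.card * ((bitsToNat z : ℝ) / 2^r)) / 2^s + 128 * d^2 / 2^s := by
  obtain ⟨hp0, hp1⟩ := p_bounds z
  set p : ℝ := (bitsToNat z : ℝ) / 2^r with hp
  have hi0 : 0 ≤ (1 - p)^(S.card - 1) := pow_nonneg (by linarith) _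
  have hi1 : (1 - p)^(S.card - 1) ≤ 1 := pow_le_one₀ (by linarith) (by linarith)
  have e1 : av (fun ω => QQ S q ω z) - (1 - p) ^ (S.card - 1)
      = av (fun ω => QQ S q ω z - (1 - p) ^ (S.card - 1)) := by
    rw [av_sub, av_const]
  rw [e1]
  refine (av_abs _).trans ?_
  have h1 : ∀ ω, |QQ S q ω z - (1 - p) ^ (S.card - 1)| ≤ ind (¬ good S b d ω) +
      (∑ x ∈ S.erase q, phi1 s z (psi ω x - psi ω q) +
      WW S.card d p * ∑ e ∈ S.offDiag, phi2 s z (psi ω e.2 - psi ω e.1)) := by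
    intro ω
    by_cases hg : good S b d ω
    · rw [ind_false (not_not.2 hg), zero_add]
      exact point_good S q hq b d hd hb ω hg z hz
    · rw [ind_true hg]
      have a1 : 0 ≤ ∑ x ∈ S.erase q, phi1 s z (psi ω x - psi ω q) :=
        Finset.sum_nonneg fun _ _ => phi1_nonneg _ _
      have a2 : 0 ≤ WW S.card d p * ∑ e ∈ S.offDiag, phi2 s z (psi ω e.2 - psi ω e.1) :=
        mul_nonneg (WW_nonneg _ _ _) (Finset.sum_nonneg fun _ _ => phi2_nonneg _ _)
      have a3 : |QQ S q ω z - (1 - p) ^ (S.card - 1)| ≤ 1 := by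
        rw [abs_le]
        have := QQ_nonneg S q ω z
        have := QQ_le_one S q ω z
        constructor <;> linarith
      linarith
  refine (av_mono h1).trans ?_
  rw [av_add, av_add, av_sum, av_mul, av_sum, add_assoc]
  refine add_le_add le_rfl (add_le_add ?_ ?_)
  · calc _ ≤ ∑ x ∈ S.erase q, 2 * p / 2^s := by
          refine Finset.sum_le_sum fun x hx => ?_
          rw [hp, ← av_phi1]
          refine av_pair_le x q (Finset.ne_of_mem_erase hx) _ (phi1_nonneg z) ?_
          intro v hv; unfold phi1; rw [ind_false hv, zero_mul]
      _ ≤ S.card * (2 * p / 2^s) := by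
          rw [Finset.sum_const, nsmul_eq_mul]
          refine mul_le_mul_of_nonneg_right ?_ (by positivity)
          exact_mod_cast Finset.card_erase_le
      _ = _ := by ring
  · have h2 : ∑ e ∈ S.offDiag, av (fun ω => phi2 s z (psi ω e.2 - psi ω e.1))
        ≤ S.card^2 * (2 * p^2 / 2^s) := by
      calc _ ≤ ∑ e ∈ S.offDiag, 2 * p^2 / 2^s := by
            refine Finset.sum_le_sum fun e he => ?_
            rw [hp, ← av_phi2]
            refine av_pair_le e.2 e.1 (Finset.mem_offDiag.1 he).2.2.symm _ (phi2_nonneg z) ?_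
            intro v hv; unfold phi2; rw [ind_false hv, zero_mul]
        _ ≤ _ := by
            rw [Finset.sum_const, nsmul_eq_mul]
            refine mul_le_mul_of_nonneg_right ?_ (by positivity)
            have : S.offDiag.card ≤ S.card^2 := by
              rw [Finset.offDiag_card, sq]; exact Nat.sub_le _ _
            exact_mod_cast this
    have h3 := WW_bound S.card d hd p hp0 hp1
    calc _ ≤ WW S.card d p * (S.card^2 * (2 * p^2 / 2^s)) :=
          mul_le_mul_of_nonneg_left h2 (WW_nonneg _ _ _)
      _ = 2 * ((S.card * p)^2 * WW S.card d p) / 2^s := by ring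
      _ ≤ 2 * (64 * d^2) / 2^s := by gcongr
      _ = _ := by ring

lemma tail_part (S : Finset (Key s k)) (q : Key s k) (b d : ℕ) (hd : 0 < d)
    (hb : b ≤ r) (z : Bits r) (hz : 2^b ≤ bitsToNat z) (h8 : 8 * d ≤ S.card) :
    av (fun ω => QQ S q ω z) ≤
      av (fun ω : Fin k → Bits s → Bits s × Bits r => ind (¬ good S b d ω)) +
      Real.exp (-(S.card * ((2:ℝ)^b / 2^r) / (2 * d))) := by
  rw [← av_const (Ω := Fin k → Bits s → Bits s × Bits r)
    (Real.exp (-(S.card * ((2:ℝ)^b / 2^r) / (2 * d)))), ← av_add]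
  refine av_mono fun ω => ?_
  by_cases hg : good S b d ω
  · rw [ind_false (not_not.2 hg), zero_add]
    unfold QQ
    refine (mul_le_of_le_one_left (Finset.prod_nonneg fun _ _ => aa_nonneg _ _ _ _)
      (ind_le_one _)).trans ?_
    have h1 := good_prod S ω b d hg ((2:ℝ)^b/2^r) (by positivity) hd
      (Finset.univ.erase (psi ω q).1) (psi ω q).1 (psi ω q).1 (by intro γ h _; simp [h])
    unfold WW at h1
    rw [if_pos h8] at h1
    refine le_trans (Finset.prod_le_prod (fun _ _ => aa_nonneg _ _ _ _) fun α _ => ?_) h1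
    refine (aa_anti S ω hz α).trans ?_
    have := aa_exp S ω (2^b) b d hd hb le_rfl hg.1 α
    push_cast at this
    exact this
  · rw [ind_true hg]
    have := QQ_le_one S q ω z
    have := Real.exp_pos (-(S.card * ((2:ℝ)^b / 2^r) / (2 * d)))
    linarith

lemma ideal_sum (n : ℕ) (hn : 0 < n) :
    |av (fun z : Bits r => (1 - (bitsToNat z : ℝ) / 2^r) ^ (n - 1)) - 1 / n| ≤ 1 / 2^r := by
  obtain ⟨t, rfl⟩ : ∃ t, n = t + 1 := ⟨n - 1, by omega⟩
  have hm : (0:ℝ) < 2^r := by positivity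
  have key : ∀ M : ℕ, (M:ℝ)^(t+1) ≤ (t+1) * ∑ j ∈ Finset.range M, ((j+1 : ℕ):ℝ)^t ∧
      (t+1) * ∑ j ∈ Finset.range M, ((j+1 : ℕ):ℝ)^t ≤ (M:ℝ)^(t+1) + (t+1) * M^t := by
    have step : ∀ M : ℕ, ((M+1:ℕ):ℝ)^(t+1) - (M:ℝ)^(t+1) ≤ (t+1) * ((M+1:ℕ):ℝ)^t ∧
        (t+1) * (M:ℝ)^t ≤ ((M+1:ℕ):ℝ)^(t+1) - (M:ℝ)^(t+1) := by
      intro M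
      have e := Commute.geom_sum₂_mul (Commute.all ((M+1:ℕ):ℝ) (M:ℝ)) (t+1)
      have e2 : ((M+1:ℕ):ℝ) - (M:ℝ) = 1 := by push_cast; ring
      rw [e2, mul_one] at e
      rw [← e]
      have hM : (M:ℝ) ≤ ((M+1:ℕ):ℝ) := by push_cast; linarith
      constructor
      · calc _ ≤ ∑ i ∈ Finset.range (t+1), ((M+1:ℕ):ℝ)^t := by
              refine Finset.sum_le_sum fun i hi => ?_
              have hi' : i ≤ t := by simp at hi; omega
              calc _ ≤ ((M+1:ℕ):ℝ)^i * ((M+1:ℕ):ℝ)^(t+1-1-i) := by gcongr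
                _ = _ := by rw [← pow_add]; congr 1; omega
          _ = _ := by simp
      · calc _ = ∑ i ∈ Finset.range (t+1), (M:ℝ)^t := by simp
          _ ≤ _ := by
              refine Finset.sum_le_sum fun i hi => ?_
              have hi' : i ≤ t := by simp at hi; omega
              calc _ = (M:ℝ)^i * (M:ℝ)^(t+1-1-i) := by rw [← pow_add]; congr 1; omega
                _ ≤ _ := by gcongr
    intro M
    induction M with
    | zero => simp; positivity
    | succ M ih =>
      obtain ⟨s1, s2⟩ := step M
      rw [Finset.sum_range_succ, mul_add]
      constructor
      · linarith [ih.1]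
      · linarith [ih.2]
  have hs : ∑ z : Bits r, (1 - (bitsToNat z : ℝ) / 2^r) ^ t
      = (∑ j ∈ Finset.range (2^r), ((j+1 : ℕ):ℝ)^t) / (2^r)^t := by
    rw [sum_val (fun y => (1 - (y : ℝ) / 2^r) ^ t), ← Finset.sum_range_reflect, Finset.sum_div]
    refine Finset.sum_congr rfl fun j hj => ?_
    rw [← div_pow]
    congr 1
    have hj' : j < 2^r := Finset.mem_range.1 hj
    have e : ((2^r - 1 - j : ℕ) : ℝ) = 2^r - 1 - j := by
      rw [Nat.cast_sub (by omega), Nat.cast_sub (by omega)]; push_cast; ring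
    rw [e]
    push_cast
    field_simp
    ring
  obtain ⟨k1, k2⟩ := key (2^r)
  push_cast at k1 k2
  simp only [Nat.add_sub_cancel]
  unfold av
  rw [hs, card_bits]
  push_cast
  set X := ∑ j ∈ Finset.range (2^r), ((j:ℝ)+1)^t
  have ht : (0:ℝ) < t + 1 := by positivity
  have e : X / (2^r)^t / 2^r - 1 / (t+1) = ((t+1) * X - (2^r)^(t+1)) / ((t+1) * (2^r)^(t+1)) := by
    field_simp
    ring
  have e2 : (1:ℝ) / 2^r = ((t+1) * (2^r)^t) / ((t+1) * (2^r)^(t+1)) := by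
    field_simp
    ring
  rw [e, e2, abs_of_nonneg (div_nonneg (by linarith) (by positivity))]
  gcongr
  linarith

lemma sq_le_pow (s : ℕ) : s^2 ≤ 4 * 2^s := by
  by_cases h : s < 3
  · interval_cases s <;> norm_num
  · have h3 : 3 ≤ s := by omega
    clear h
    induction s, h3 using Nat.le_induction with
    | base => norm_num
    | succ j hj ih => rw [pow_succ 2 j]; nlinarith

lemma pw (n N X c : ℝ) (k : ℕ) (hX : 0 ≤ X) (hc : X^2 ≤ c * N) (hn : 0 < n)
    (hnN : n ≤ N^(k+1)) (hN : 1 ≤ N) : n * (X / N)^(4*k+6) ≤ c^(2*k+3) / (n * N) := by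
  have hN0 : 0 < N := by linarith
  have e : (X/N)^(4*k+6) = (X^2/N^2)^(2*k+3) := by
    rw [← div_pow, ← pow_mul]; congr 1; ring
  have h1 : X^2/N^2 ≤ c / N := by
    rw [div_le_div_iff₀ (by positivity) hN0]
    nlinarith
  have h2 : (X/N)^(4*k+6) ≤ c^(2*k+3) / N^(2*k+3) := by
    rw [e, ← div_pow c]
    exact pow_le_pow_left₀ (by positivity) h1 _
  have hc0 : 0 ≤ c := by
    by_contra h
    nlinarith [sq_nonneg X]
  have h3 : n * n * N ≤ N^(2*k+3) := by
    calc n * n * N ≤ N^(k+1) * N^(k+1) * N := by gcongr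
      _ = _ := by ring
  rw [le_div_iff₀ (by positivity)]
  calc n * (X/N)^(4*k+6) * (n * N) = (X/N)^(4*k+6) * (n * n * N) := by ring
    _ ≤ c^(2*k+3) / N^(2*k+3) * N^(2*k+3) := by gcongr
    _ = _ := by field_simp

lemma core (hk : 1 ≤ k) (S : Finset (Key s k)) (q : Key s k) (hq : q ∈ S) (Λ : ℝ) (hΛ1 : 1 ≤ Λ)
    (hΛ2 : Λ ≤ (k+1) * s) (hΛe : Real.exp Λ = ((2:ℝ)^s)^(k+1)) (hnm : (S.card : ℝ) * 2^s ≤ 2^r)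
    (hnu : (S.card : ℝ) ≤ ((2:ℝ)^s)^(k+1)) (d : ℕ) (hd : d = (4*k+6+1)^k) (A K K1 : ℝ)
    (hA : A = 8 * d) (hK : K = (16 * A^2 * (k+1)^2)^(2*k+3) + 64^(2*k+3))
    (hK1 : K1 = K + 4 * A + 128 * d^2) :
    |av (fun z : Bits r => av (fun ω => QQ S q ω z)) - 1 / S.card| ≤
      (2 * A * K1 + K + 3) * Λ^2 / 2^s / S.card := by
  have hd0 : 0 < d := by rw [hd]; positivity
  have hd1 : (1:ℝ) ≤ d := by exact_mod_cast hd0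
  have hn0 : 0 < S.card := Finset.card_pos.2 ⟨q, hq⟩
  have hn1 : (1:ℝ) ≤ S.card := by exact_mod_cast hn0
  set n : ℝ := (S.card : ℝ) with hn
  set N : ℝ := (2:ℝ)^s with hN
  set m : ℝ := (2:ℝ)^r with hm
  have hN1 : 1 ≤ N := one_le_pow₀ (by norm_num)
  have hm0 : 0 < m := by positivity
  have hN0 : 0 < N := by positivity
  have hn0' : 0 < n := by positivity
  have hnN0 : 0 < n * N := by positivity
  have hA8 : 8 ≤ A := by rw [hA]; linarith
  set L : ℝ := A * Λ with hL
  have hLA : A ≤ L := by rw [hL]; nlinarith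
  have hK0 : 0 ≤ K := by rw [hK]; positivity
  -- choice of b
  set P : ℕ → Prop := fun b => n * 2^b ≤ 2 * L * m with hP
  have hP0 : P 0 := by
    simp only [hP, pow_zero, mul_one]
    nlinarith
  set b := Nat.findGreatest P r with hbdef
  have hbr : b ≤ r := Nat.findGreatest_le r
  have hPb : n * 2^b ≤ 2 * L * m := Nat.findGreatest_spec (P := P) (Nat.zero_le r) hP0
  have hPb' : b < r → L * m ≤ n * 2^b := by
    intro h
    have h1 : ¬ P (b+1) := Nat.findGreatest_is_greatest (Nat.lt_succ_self _) h
    simp only [hP, not_le, pow_succ] at h1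
    nlinarith
  have hratio : n * (2^b / m) ≤ 2 * L := by
    rw [← mul_div_assoc, div_le_iff₀ hm0]; exact hPb
  -- bad probability
  have hbad := bad_prob S (4*k+6) b hbr hn0
  rw [← hd] at hbad
  set B := av (fun ω : Fin k → Bits s → Bits s × Bits r => ind (¬ good S b d ω)) with hB
  have hBK : B ≤ K / (n * N) := by
    refine hbad.trans ?_
    rw [hK, add_div]
    refine add_le_add ?_ ?_
    · have hX : n * 2^b / (N * m) ≤ 2 * L / N := by
        rw [mul_comm N m, ← div_div, mul_div_assoc]
        gcongr
      calc n * (n * 2^b / (N * m))^(4*k+6) ≤ n * (2 * L / N)^(4*k+6) := by gcongr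
        _ ≤ _ := by
          refine pw n N (2*L) _ k (by positivity) ?_ hn0' hnu hN1
          have h1 : Λ^2 ≤ ((k+1) * s)^2 := by gcongr
          have h2 : (s:ℝ)^2 ≤ 4 * N := by
            have := sq_le_pow s
            rw [hN]; exact_mod_cast this
          calc (2*L)^2 = 4 * A^2 * Λ^2 := by rw [hL]; ring
            _ ≤ 4 * A^2 * ((k+1) * s)^2 := by gcongr
            _ = 4 * A^2 * (k+1)^2 * s^2 := by ring
            _ ≤ 4 * A^2 * (k+1)^2 * (4 * N) := by gcongr
            _ = _ := by ring
    · exact pw n N 8 64 k (by norm_num) (by linarith) hn0' hnu hN1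
  have hinv : 1 / (n * N) ≤ Λ / N := by
    rw [div_le_div_iff₀ hnN0 hN0]
    nlinarith [mul_le_mul hn1 hΛ1 (by norm_num) (by linarith)]
  have hexp : Real.exp (-(4*Λ)) ≤ 1 / (n * N) := by
    rw [Real.exp_neg, ← one_div]
    refine one_div_le_one_div_of_le hnN0 ?_
    have h1 : Real.exp (2*Λ) = ((2:ℝ)^s)^(k+1) * ((2:ℝ)^s)^(k+1) := by
      rw [two_mul, Real.exp_add, hΛe]
    have h2 : n * N ≤ Real.exp (2*Λ) := by
      rw [h1]
      have : N ≤ N^(k+1) := le_self_pow₀ hN1 (by omega)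
      exact mul_le_mul hnu this hN0.le (by positivity)
    refine h2.trans (Real.exp_le_exp.2 (by linarith))
  -- pointwise
  have hpt : ∀ z : Bits r, |av (fun ω => QQ S q ω z) - (1 - (bitsToNat z : ℝ) / 2^r) ^ (S.card - 1)|
      ≤ K1 * Λ / N * ind (bitsToNat (0 + z) < 2^b) + (K + 2) / (n * N) := by
    intro z
    rw [zero_add]
    by_cases hz : bitsToNat z < 2^b
    · rw [ind_true hz, mul_one]
      have h1 := main_part S q hq b d hd0 hbr z hz.le
      have h2 : n * ((bitsToNat z : ℝ) / m) ≤ 2 * L := by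
        refine le_trans ?_ hratio
        have : (bitsToNat z : ℝ) ≤ 2^b := by exact_mod_cast hz.le
        gcongr
      have h3 : 2 * (n * ((bitsToNat z : ℝ) / m)) / N ≤ 4 * A * (Λ / N) := by
        calc _ ≤ 2 * (2 * L) / N := by gcongr
          _ = _ := by rw [hL]; ring
      have h4 : 128 * (d:ℝ)^2 / N ≤ 128 * d^2 * (Λ / N) := by
        rw [mul_div_assoc', div_le_div_iff_of_pos_right hN0]
        exact le_mul_of_one_le_right (by positivity) hΛ1
      have h5 : K / (n*N) ≤ K * (Λ / N) := by
        calc K / (n*N) = K * (1/(n*N)) := by ring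
          _ ≤ _ := by gcongr
      have h6 : 0 ≤ (K+2)/(n*N) := by positivity
      have h7 : K1 * Λ / N = K * (Λ / N) + 4 * A * (Λ/N) + 128 * d^2 * (Λ/N) := by
        rw [hK1]; ring
      rw [h7]
      linarith
    · rw [ind_false hz, mul_zero, zero_add]
      push Not at hz
      have hbr' : b < r := by
        have := hz.trans_lt (val_lt z)
        exact (Nat.pow_lt_pow_iff_right (by norm_num)).1 this
      have h1 : L ≤ n * (2^b / m) := by
        rw [← mul_div_assoc, le_div_iff₀ hm0]; exact hPb' hbr'
      have hzb : (2:ℝ)^b ≤ bitsToNat z := by exact_mod_cast hz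
      obtain ⟨hp0, hp1⟩ := p_bounds z
      set p : ℝ := (bitsToNat z : ℝ) / 2^r with hp
      have h2 : L ≤ n * p := h1.trans (by rw [hp]; gcongr)
      have h3 : L ≤ n := h2.trans (mul_le_of_le_one_right hn0'.le hp1)
      have h8 : 8 * d ≤ S.card := by
        have : (8:ℝ) * d ≤ S.card := by rw [← hA, ← hn]; linarith
        exact_mod_cast this
      have ht := tail_part S q b d hd0 hbr z hz h8
      have ht2 : Real.exp (-(n * ((2:ℝ)^b / m) / (2 * d))) ≤ 1 / (n*N) := by
        refine le_trans (Real.exp_le_exp.2 ?_) hexp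
        rw [neg_le_neg_iff, le_div_iff₀ (by positivity)]
        calc 4 * Λ * (2 * d) = L := by rw [hL, hA]; ring
          _ ≤ _ := h1
      have hid : (1 - p)^(S.card - 1) ≤ 1 / (n*N) := by
        refine le_trans ?_ hexp
        calc (1-p)^(S.card - 1) ≤ (Real.exp (-p))^(S.card - 1) := by
              refine pow_le_pow_left₀ (by linarith) ?_ _
              have := Real.add_one_le_exp (-p); linarith
          _ = Real.exp (-((n-1) * p)) := by
              rw [← Real.exp_nat_mul, Nat.cast_sub hn0]
              congr 1; push_cast; ring
          _ ≤ _ := by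
              refine Real.exp_le_exp.2 ?_
              have h9 : n ≤ 2 * (n - 1) := by linarith
              have h10 : n * p ≤ 2 * (n-1) * p := by gcongr
              have h11 : 8 * Λ ≤ L := by rw [hL]; gcongr
              linarith
      have hid0 : 0 ≤ (1 - p)^(S.card - 1) := pow_nonneg (by linarith) _
      have hq0 : 0 ≤ av (fun ω => QQ S q ω z) := av_nonneg fun ω => QQ_nonneg _ _ _ _
      have hsplit : (K+2)/(n*N) = K/(n*N) + 1/(n*N) + 1/(n*N) := by ring
      rw [hsplit]
      have hK' : 0 ≤ K/(n*N) := by positivity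
      have h1' : 0 ≤ 1/(n*N) := by positivity
      rw [abs_le]
      constructor <;> linarith
  have hideal := ideal_sum (r := r) S.card hn0
  have hmn : 1 / m ≤ 1 / (n*N) := one_div_le_one_div_of_le hnN0 hnm
  have hK10 : 0 ≤ K1 := by rw [hK1]; positivity
  have hav : |av (fun z : Bits r => av (fun ω => QQ S q ω z)) -
      av (fun z : Bits r => (1 - (bitsToNat z : ℝ) / 2^r) ^ (S.card - 1))|
      ≤ K1 * Λ / N * (2 * L / n) + (K+2)/(n*N) := by
    rw [← av_sub]
    refine (av_abs _).trans ((av_mono hpt).trans ?_)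
    rw [av_add, av_const, av_mul, av_ind_lt (2^b) (Nat.pow_le_pow_right (by norm_num) hbr) 0]
    have : (((2^b : ℕ) : ℝ)) / 2^r ≤ 2 * L / n := by
      rw [le_div_iff₀ hn0']; push_cast; linarith
    gcongr
  have hfin : K1 * Λ / N * (2 * L / n) + (K+2)/(n*N) + 1/(n*N)
      ≤ (2 * A * K1 + K + 3) * Λ^2 / N / n := by
    have e1 : K1 * Λ / N * (2 * L / n) + (K+2)/(n*N) + 1/(n*N)
        = (2 * A * K1 * Λ^2 + (K + 3)) / N / n := by
      rw [hL]; field_simp; ring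
    rw [e1]
    gcongr
    have : 1 ≤ Λ^2 := one_le_pow₀ hΛ1
    nlinarith
  refine le_trans (abs_sub_le _ (av (fun z : Bits r => (1 - (bitsToNat z : ℝ) / 2^r) ^ (S.card - 1))) _) ?_
  linarith

lemma card_key : (Fintype.card (Key s k) : ℝ) = ((2:ℝ)^s)^(k+1) := by
  have h : Fintype.card (Fin k → Bits s) = (2^s)^k := by
    rw [Fintype.card_pi_const, card_bits]
  rw [Fintype.card_prod, h, card_bits]
  push_cast; ring

lemma pr_one {Ω : Type*} [Fintype Ω] [Nonempty Ω] (E : Ω → Prop) (h : ∀ ω, E ω) : Pr E = 1 := by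
  unfold Pr
  rw [Finset.filter_true_of_mem (fun ω _ => h ω), Finset.card_univ]
  exact div_self (by exact_mod_cast Fintype.card_ne_zero)

end TTM

/-- Twisted tabulation is `ε`-minwise independent with bias depending
only on the universe (Theorem 6): for every constant `c = k+1 ≥ 2` there is a constant
`C` such that for a set `S` of `n` keys, `q ∈ S`, and a random twisted tabulation
function into `m = 2^r ≥ n·u^{1/c}` bins, `Pr[h(q) = min h(S)] = (1 ± ε)/n` where
`ε = C·(log u)²/u^{1/c}` and `u = |Σ|^c` is the size of the universe.
(The event `h(q) = min h(S)` is expressed as: `h(q) ≤ h(x)` for all `x ∈ S`.) -/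
theorem twisted_tabulation_minwise (k : ℕ) (hk : 1 ≤ k) :
    ∃ C : ℝ,
      ∀ (s r : ℕ) (S : Finset (Key s k)) (q : Key s k),
        q ∈ S →
        (S.card : ℝ) * (Fintype.card (Key s k) : ℝ) ^ ((1 : ℝ) / (k + 1 : ℝ)) ≤
          (2 : ℝ) ^ r →
        |Pr (fun ω : (Fin k → Bits s → Bits s × Bits r) × (Bits s → Bits r) =>
              ∀ x ∈ S, bitsToNat (twistedTab ω q) ≤ bitsToNat (twistedTab ω x)) -
            1 / (S.card : ℝ)| ≤
          (C * Real.log (Fintype.card (Key s k)) ^ 2 /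
              (Fintype.card (Key s k) : ℝ) ^ ((1 : ℝ) / (k + 1 : ℝ))) /
            (S.card : ℝ) := by
  set d : ℕ := (4*k+6+1)^k with hd
  set A : ℝ := 8 * d with hA
  set K : ℝ := (16 * A^2 * (k+1)^2)^(2*k+3) + 64^(2*k+3) with hK
  set K1 : ℝ := K + 4 * A + 128 * d^2 with hK1
  refine ⟨2 * A * K1 + K + 3, ?_⟩
  intro s r S q hq hm
  have hroot : (Fintype.card (Key s k) : ℝ) ^ ((1 : ℝ) / (k + 1 : ℝ)) = 2^s := by
    rw [TTM.card_key, one_div]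
    have := Real.pow_rpow_inv_natCast (x := (2:ℝ)^s) (by positivity) (n := k+1) (by omega)
    push_cast at this
    exact this
  rw [hroot] at hm ⊢
  rcases Nat.eq_zero_or_pos s with hs | hs
  · subst hs
    have hS : S = {q} := by
      ext x
      simp only [Finset.mem_singleton]
      have : x = q := Subsingleton.elim _ _
      simp [this, hq]
    subst hS
    have h1 : Pr (fun ω : (Fin k → Bits 0 → Bits 0 × Bits r) × (Bits 0 → Bits r) =>
              ∀ x ∈ ({q} : Finset (Key 0 k)),
                bitsToNat (twistedTab ω q) ≤ bitsToNat (twistedTab ω x)) = 1 := by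
      refine TTM.pr_one _ fun ω x hx => ?_
      rw [Finset.mem_singleton.1 hx]
    rw [h1, TTM.card_key]
    simp
  · rw [TTM.pr_eq]
    have hlog : Real.log (Fintype.card (Key s k)) = (k+1) * s * Real.log 2 := by
      rw [TTM.card_key, Real.log_pow, Real.log_pow]; push_cast; ring
    have hk' : (1:ℝ) ≤ k := by exact_mod_cast hk
    have hs' : (1:ℝ) ≤ s := by exact_mod_cast hs
    have hks : (2:ℝ) ≤ (k+1) * s := by nlinarith
    refine TTM.core hk S q hq _ ?_ ?_ ?_ hm ?_ d hd A K K1 hA hK hK1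
    · rw [hlog]; nlinarith [Real.log_two_gt_d9]
    · rw [hlog]; nlinarith [Real.log_two_lt_d9]
    · rw [Real.exp_log (by rw [TTM.card_key]; positivity), TTM.card_key]
    · rw [← TTM.card_key]; exact_mod_cast Finset.card_le_univ S
end
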